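/- arXiv:2411.19163 — 3 statements merged into one kernel-verified Lean document; each statement's English description precedes it below -/
import Mathlib

section
/- Let d≥2 and m∈{1,…,d} be integers and let d_1,…,d_m be positive integers with d_1+…+d_m=d. Let X_1,…,X_n be i.i.d. uniform random points in Z_𝕕=B_2^{d_1}×…×B_2^{d_m} and P_n=conv{X_1,…,X_n}. Set d_max=max_i d_i and #d_max=#{i : d_i=d_max}. Then Vol_d(Z_𝕕) − E Vol_d(P_n) ≍ n^{−2/(d_max+1)} (ln n)^{#d_max−1}, with implied constants depending only on (d_1,…,d_m). -/
open MeasureTheory Filter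

noncomputable section

/-- The product body `Z_𝕕 = B_2^{d_1} × ⋯ × B_2^{d_m}`, the product of centered
Euclidean unit balls, realized in `ℝ^{d_1} × ⋯ × ℝ^{d_m}`. -/
def prodOfBalls {m : ℕ} (dv : Fin m → ℕ) : Set (Π i, EuclideanSpace ℝ (Fin (dv i))) :=
  Set.univ.pi fun i => Metric.closedBall (0 : EuclideanSpace ℝ (Fin (dv i))) 1

/-- The uniform distribution (normalized Lebesgue measure) on a set `K`. -/
def uniformDist {α : Type*} [MeasureSpace α] (K : Set α) : Measure α :=
  (volume K)⁻¹ • volume.restrict K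

/-- Expected volume of the convex hull of `n` i.i.d. uniform random points in `Z_𝕕`. -/
def expectedVolume {m : ℕ} (dv : Fin m → ℕ) (n : ℕ) : ℝ :=
  ∫ x : Fin n → Π i, EuclideanSpace ℝ (Fin (dv i)),
    (volume (convexHull ℝ (Set.range x))).toReal
    ∂(Measure.pi fun _ : Fin n => uniformDist (prodOfBalls dv))

open Set Real in
theorem setLIntegral_Ioc_ofReal_of_hasDerivAt {F f : ℝ → ℝ} {a b : ℝ} (hab : a ≤ b)
    (hF : ∀ t ∈ Icc a b, HasDerivAt F (f t) t) (hf : ContinuousOn f (Icc a b))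
    (hf0 : ∀ t ∈ Icc a b, 0 ≤ f t) :
    ∫⁻ t in Ioc a b, ENNReal.ofReal (f t) = ENNReal.ofReal (F b - F a) := by
  have hint : IntervalIntegrable f volume a b := by
    apply ContinuousOn.intervalIntegrable
    rwa [uIcc_of_le hab]
  rw [← intervalIntegral.integral_eq_sub_of_hasDerivAt (by rwa [uIcc_of_le hab]) hint,
    intervalIntegral.integral_of_le hab, ofReal_integral_eq_lintegral_ofReal hint.1]
  filter_upwards [ae_restrict_mem measurableSet_Ioc] with t ht
  exact hf0 t (Ioc_subset_Icc_self ht)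

open Set in
theorem setLIntegral_inv_one_add_mul_sq (N : ℝ) (hN : 0 ≤ N) :
    ∫⁻ t in Ioc (0 : ℝ) 1, ENNReal.ofReal (1 / (1 + N * t) ^ 2) =
      ENNReal.ofReal (1 / (1 + N)) := by
  have hpos : ∀ t ∈ Icc (0 : ℝ) 1, 0 < 1 + N * t := fun t ht => by
    have := mul_nonneg hN ht.1
    linarith
  rw [setLIntegral_Ioc_ofReal_of_hasDerivAt (F := fun t => t / (1 + N * t)) zero_le_one]
  · simp
  · intro t ht
    have h := ((hasDerivAt_id t).div (((hasDerivAt_id t).const_mul N).const_add 1)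
      (hpos t ht).ne')
    refine h.congr_deriv ?_
    simp [mul_comm t N]
  · exact ContinuousOn.div (by fun_prop) (by fun_prop) fun t ht => by
      have := hpos t ht; positivity
  · intro t ht
    have := hpos t ht; positivity

open Set in
theorem setLIntegral_inv_one_add_mul_le (N : ℝ) (hN : 0 ≤ N) :
    ∫⁻ t in Ioc (0 : ℝ) 1, ENNReal.ofReal (1 / (1 + N * t)) ≤
      ENNReal.ofReal ((1 + Real.log (1 + N)) / (1 + N)) := by
  have hpos : ∀ t ∈ Icc (0 : ℝ) 1, 0 < 1 + N * t := fun t ht => by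
    have := mul_nonneg hN ht.1
    linarith
  have key : ∫⁻ t in Ioc (0 : ℝ) 1, ENNReal.ofReal (1 / (1 + N) * (1 + N / (1 + N * t))) =
      ENNReal.ofReal ((1 + Real.log (1 + N)) / (1 + N)) := by
    rw [setLIntegral_Ioc_ofReal_of_hasDerivAt
      (F := fun t => 1 / (1 + N) * (t + Real.log (1 + N * t))) zero_le_one]
    · congr 1
      simp
      ring
    · intro t ht
      have h := ((hasDerivAt_id t).add ((((hasDerivAt_id t).const_mul N).const_add 1).log
        (hpos t ht).ne')).const_mul (1 / (1 + N))
      refine h.congr_deriv ?_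
      simp
    · refine ContinuousOn.mul continuousOn_const (continuousOn_const.add ?_)
      exact ContinuousOn.div (by fun_prop) (by fun_prop) fun t ht => (hpos t ht).ne'
    · intro t ht
      have := hpos t ht; positivity
  rw [← key]
  refine setLIntegral_mono' measurableSet_Ioc fun t ht => ENNReal.ofReal_le_ofReal ?_
  have h1 := hpos t (Ioc_subset_Icc_self ht)
  rw [div_mul_eq_mul_div, one_mul, div_le_div_iff₀ h1 (by positivity), add_mul,
    div_mul_cancel₀ _ h1.ne']
  nlinarith [mul_nonneg hN ht.1.le]

open Set in
theorem setLIntegral_inv_one_add_mul_rpow_le (r : ℝ) (hr0 : 0 < r) (hr : r < 1)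
    (N : ℝ) (hN : 0 ≤ N) :
    ∫⁻ t in Ioc (0 : ℝ) 1, ENNReal.ofReal (1 / (1 + N * t ^ r)) ≤
      ENNReal.ofReal (1 / (1 - r) / (1 + N)) := by
  have hint : IntervalIntegrable (fun t : ℝ => 1 / (1 + N) * t ^ (-r)) volume 0 1 :=
    (intervalIntegral.intervalIntegrable_rpow' (by linarith)).const_mul _
  have key : ∫⁻ t in Ioc (0 : ℝ) 1, ENNReal.ofReal (1 / (1 + N) * t ^ (-r)) =
      ENNReal.ofReal (1 / (1 - r) / (1 + N)) := by
    rw [← ofReal_integral_eq_lintegral_ofReal hint.1,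
      ← intervalIntegral.integral_of_le zero_le_one, intervalIntegral.integral_const_mul,
      integral_rpow (Or.inl (by linarith))]
    · congr 1
      rw [Real.one_rpow, Real.zero_rpow (by linarith), neg_add_eq_sub]
      ring
    · filter_upwards [ae_restrict_mem measurableSet_Ioc] with t ht
      have := Real.rpow_nonneg ht.1.le (-r)
      positivity
  rw [← key]
  refine setLIntegral_mono' measurableSet_Ioc fun t ht => ENNReal.ofReal_le_ofReal ?_
  have h1 : 0 < t ^ r := Real.rpow_pos_of_pos ht.1 r
  have h2 : t ^ r ≤ 1 := Real.rpow_le_one ht.1.le ht.2 hr0.le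
  rw [Real.rpow_neg ht.1.le, ← one_div, div_mul_div_comm, one_mul]
  apply one_div_le_one_div_of_le (by positivity)
  nlinarith

open Set in
theorem le_setLIntegral_indicator (N : ℝ) (hN : 0 ≤ N) :
    ENNReal.ofReal (1 / 2 / (1 + N)) ≤
      ∫⁻ t in Ioc (0 : ℝ) (1 / 2), ENNReal.ofReal (if N * t ≤ 1 then 1 else 0) := by
  have hle : 1 / 2 / (1 + N) ≤ 1 / 2 := div_le_self (by norm_num) (by linarith)
  calc ENNReal.ofReal (1 / 2 / (1 + N))
      = ∫⁻ t in Ioc (0 : ℝ) (1 / 2 / (1 + N)), 1 := by simp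
    _ ≤ ∫⁻ t in Ioc (0 : ℝ) (1 / 2 / (1 + N)), ENNReal.ofReal (if N * t ≤ 1 then 1 else 0) := by
        refine setLIntegral_mono' measurableSet_Ioc fun t ht => ?_
        have : N * t ≤ 1 := by
          have h1 := ht.2
          rw [le_div_iff₀ (by positivity)] at h1
          nlinarith [ht.1]
        simp [this]
    _ ≤ _ := lintegral_mono_set (Ioc_subset_Ioc_right hle)

open Set in
theorem le_setLIntegral_log_pow_div (K : ℕ) (N : ℝ) (hN : 0 ≤ N) :
    ENNReal.ofReal (1 / (2 ^ (K + 1) * (K + 1)) * (Real.log (1 + N) ^ (K + 1) / (1 + N))) ≤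
      ∫⁻ t in Ioc (0 : ℝ) (1 / 2), ENNReal.ofReal (Real.log (1 + N * t) ^ K / (1 + N * t)) := by
  have hpos : ∀ t ∈ Icc (0 : ℝ) (1 / 2), 1 ≤ 1 + N * t := fun t ht => by
    have := mul_nonneg hN ht.1
    linarith
  have hpos' : ∀ t ∈ Icc (0 : ℝ) (1 / 2), 0 < 1 + N * t := fun t ht =>
    zero_lt_one.trans_le (hpos t ht)
  have hlog : ∀ t ∈ Icc (0 : ℝ) (1 / 2), 0 ≤ Real.log (1 + N * t) := fun t ht =>
    Real.log_nonneg (hpos t ht)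
  have key : ∫⁻ t in Ioc (0 : ℝ) (1 / 2),
      ENNReal.ofReal (1 / (1 + N) * (Real.log (1 + N * t) ^ K * (N / (1 + N * t)))) =
      ENNReal.ofReal (1 / (1 + N) * (Real.log (1 + N * (1 / 2)) ^ (K + 1) / (K + 1))) := by
    rw [setLIntegral_Ioc_ofReal_of_hasDerivAt
      (F := fun t => 1 / (1 + N) * (Real.log (1 + N * t) ^ (K + 1) / (K + 1))) (by norm_num)]
    · congr 1
      simp
    · intro t ht
      have h := ((((((hasDerivAt_id t).const_mul N).const_add 1).log
        (hpos' t ht).ne').pow (K + 1)).div_const ((K : ℝ) + 1)).const_mul (1 / (1 + N))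
      refine h.congr_deriv ?_
      simp
      field_simp
      simp
    · refine ContinuousOn.mul continuousOn_const (ContinuousOn.mul ?_ ?_)
      · exact (ContinuousOn.log (by fun_prop) fun t ht => (hpos' t ht).ne').pow K
      · exact ContinuousOn.div (by fun_prop) (by fun_prop) fun t ht => (hpos' t ht).ne'
    · intro t ht
      have := hpos' t ht
      have := hlog t ht
      positivity
  have hlog2 : Real.log (1 + N) ≤ 2 * Real.log (1 + N * (1 / 2)) := by
    rw [← Real.log_rpow (by positivity)]
    apply Real.log_le_log (by positivity)
    norm_num
    nlinarith
  calc _ ≤ ENNReal.ofReal (1 / (1 + N) * (Real.log (1 + N * (1 / 2)) ^ (K + 1) / (K + 1))) := by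
        apply ENNReal.ofReal_le_ofReal
        have h0 : 0 ≤ Real.log (1 + N) := Real.log_nonneg (by linarith)
        have h1 := pow_le_pow_left₀ h0 hlog2 (K + 1)
        rw [mul_pow] at h1
        rw [one_div, inv_mul_eq_div, div_div, div_mul_div_comm, one_mul,
          div_le_div_iff₀ (by positivity) (by positivity)]
        calc _ ≤ (2 ^ (K + 1) * Real.log (1 + N * (1 / 2)) ^ (K + 1)) * ((1 + N) * (K + 1)) := by
              gcongr
          _ = _ := by ring
    _ ≤ _ := by
        rw [← key]
        refine setLIntegral_mono' measurableSet_Ioc fun t ht => ENNReal.ofReal_le_ofReal ?_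
        have h1 := hpos' t (Ioc_subset_Icc_self ht)
        have h2 := hlog t (Ioc_subset_Icc_self ht)
        rw [div_eq_mul_one_div (Real.log (1 + N * t) ^ K), mul_left_comm]
        gcongr
        rw [div_mul_div_comm, div_le_div_iff₀ (by positivity) h1]
        nlinarith

open Set Module in
theorem lintegral_fun_norm_addHaar {E : Type*} [NormedAddCommGroup E] [NormedSpace ℝ E]
    [MeasurableSpace E] [BorelSpace E] [Nontrivial E] [FiniteDimensional ℝ E]
    (μ : Measure E) [μ.IsAddHaarMeasure] {f : ℝ → ENNReal} (hf : Measurable f) :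
    ∫⁻ x, f ‖x‖ ∂μ =
      μ.toSphere univ * ∫⁻ y in Ioi (0 : ℝ), ENNReal.ofReal (y ^ (finrank ℝ E - 1)) * f y :=
  calc
    ∫⁻ x, f ‖x‖ ∂μ = ∫⁻ x : ({(0)}ᶜ : Set E), f ‖x.1‖ ∂(μ.comap (↑)) := by
      rw [lintegral_subtype_comap (measurableSet_singleton _).compl fun x => f ‖x‖,
        restrict_compl_singleton]
    _ = ∫⁻ x, f x.2 ∂μ.toSphere.prod (.volumeIoiPow (finrank ℝ E - 1)) := by
      simpa using μ.measurePreserving_homeomorphUnitSphereProd.lintegral_comp_emb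
        (Homeomorph.measurableEmbedding _) (f ∘ Subtype.val ∘ Prod.snd)
    _ = μ.toSphere univ * ∫⁻ x : Ioi (0 : ℝ), f x ∂.volumeIoiPow (finrank ℝ E - 1) := by
      rw [lintegral_prod _ (by fun_prop)]
      simp [mul_comm]
    _ = _ := by
      rw [Measure.volumeIoiPow, lintegral_withDensity_eq_lintegral_mul _ (by fun_prop)
        (by fun_prop)]
      congr 1
      exact lintegral_subtype_comap measurableSet_Ioi
        fun y : ℝ => ENNReal.ofReal (y ^ (finrank ℝ E - 1)) * f y

open Set Module in
/-- Integrals over the unit ball of a function of the distance to the boundary sphere. -/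
theorem setLIntegral_closedBall_one_sub_norm {E : Type*} [NormedAddCommGroup E]
    [NormedSpace ℝ E] [MeasurableSpace E] [BorelSpace E] [Nontrivial E] [FiniteDimensional ℝ E]
    (μ : Measure E) [μ.IsAddHaarMeasure] {f : ℝ → ENNReal} (hf : Measurable f) :
    ∫⁻ x in Metric.closedBall (0 : E) 1, f (1 - ‖x‖) ∂μ =
      μ.toSphere univ *
        ∫⁻ t in Ioc (0 : ℝ) 1, ENNReal.ofReal ((1 - t) ^ (finrank ℝ E - 1)) * f t := by
  have h1 : ∫⁻ x in Metric.closedBall (0 : E) 1, f (1 - ‖x‖) ∂μ =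
      ∫⁻ x : E, (Iic (1 : ℝ)).indicator (fun r => f (1 - r)) ‖x‖ ∂μ := by
    rw [← lintegral_indicator Metric.isClosed_closedBall.measurableSet]
    refine lintegral_congr fun x => ?_
    simp [indicator]
  have h2 : ∀ y : ℝ, ENNReal.ofReal (y ^ (finrank ℝ E - 1)) *
      (Iic (1 : ℝ)).indicator (fun r => f (1 - r)) y =
      (Iic (1 : ℝ)).indicator
        (fun r => ENNReal.ofReal (r ^ (finrank ℝ E - 1)) * f (1 - r)) y := fun y => by
    simp [indicator]
  rw [h1, lintegral_fun_norm_addHaar μ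
    (Measurable.indicator (by fun_prop) measurableSet_Iic)]
  simp_rw [h2]
  rw [lintegral_indicator measurableSet_Iic, Measure.restrict_restrict measurableSet_Iic,
    inter_comm, Ioi_inter_Iic, setLIntegral_congr (Ico_ae_eq_Ioc (μ := volume)).symm,
    ← lintegral_indicator measurableSet_Ioc, ← lintegral_indicator measurableSet_Ico,
    ← lintegral_sub_left_eq_self _ (1 : ℝ)]
  congr 1
  refine lintegral_congr fun t => ?_
  simp [indicator, and_comm]

theorem exists_setLIntegral_closedBall_eq (d : ℕ) (hd : 1 ≤ d) :
    ∃ κ : ℝ, 0 < κ ∧ ∀ f : ℝ → ENNReal, Measurable f →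
      ∫⁻ x in Metric.closedBall (0 : EuclideanSpace ℝ (Fin d)) 1, f (1 - ‖x‖) =
        ENNReal.ofReal κ *
          ∫⁻ t in Set.Ioc (0 : ℝ) 1, ENNReal.ofReal ((1 - t) ^ (d - 1)) * f t := by
  have : Nonempty (Fin d) := ⟨⟨0, hd⟩⟩
  let σ := (volume : Measure (EuclideanSpace ℝ (Fin d))).toSphere Set.univ
  have hσ : σ ≠ ⊤ := measure_ne_top _ _
  have hσ0 : σ ≠ 0 := by
    rw [Measure.measure_univ_ne_zero]
    exact Measure.toSphere_ne_zero _
  refine ⟨σ.toReal, ENNReal.toReal_pos hσ0 hσ, fun f hf => ?_⟩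
  rw [ENNReal.ofReal_toReal hσ, setLIntegral_closedBall_one_sub_norm volume hf,
    finrank_euclideanSpace_fin]

theorem exists_setLIntegral_closedBall_le (d : ℕ) (hd : 1 ≤ d) :
    ∃ κ : ℝ, 0 < κ ∧ ∀ f : ℝ → ENNReal, Measurable f →
      ∫⁻ x in Metric.closedBall (0 : EuclideanSpace ℝ (Fin d)) 1, f (1 - ‖x‖) ≤
        ENNReal.ofReal κ * ∫⁻ t in Set.Ioc (0 : ℝ) 1, f t := by
  obtain ⟨κ, hκ, h⟩ := exists_setLIntegral_closedBall_eq d hd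
  refine ⟨κ, hκ, fun f hf => ?_⟩
  rw [h f hf]
  gcongr ENNReal.ofReal κ * ?_
  refine setLIntegral_mono' measurableSet_Ioc fun t ht => mul_le_of_le_one_left' ?_
  rw [ENNReal.ofReal_le_one]
  exact pow_le_one₀ (by linarith [ht.2]) (by linarith [ht.1])

theorem exists_le_setLIntegral_closedBall (d : ℕ) (hd : 1 ≤ d) :
    ∃ κ : ℝ, 0 < κ ∧ ∀ f : ℝ → ENNReal, Measurable f →
      ENNReal.ofReal κ * ∫⁻ t in Set.Ioc (0 : ℝ) (1 / 2), f t ≤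
      ∫⁻ x in Metric.closedBall (0 : EuclideanSpace ℝ (Fin d)) 1, f (1 - ‖x‖) := by
  obtain ⟨κ, hκ, h⟩ := exists_setLIntegral_closedBall_eq d hd
  refine ⟨κ * (1 / 2) ^ (d - 1), by positivity, fun f hf => ?_⟩
  rw [h f hf, ENNReal.ofReal_mul hκ.le, mul_assoc, ← lintegral_const_mul _ hf]
  gcongr ENNReal.ofReal κ * ?_
  refine (setLIntegral_mono' measurableSet_Ioc fun t ht => ?_).trans
    (lintegral_mono_set (Set.Ioc_subset_Ioc_right (by norm_num)))
  gcongr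
  linarith [ht.2]

section ProductIntegrals

variable {ι : Type*} [DecidableEq ι] {Ω : ι → Type*} [∀ i, MeasurableSpace (Ω i)]
  (μ : ∀ i, Measure (Ω i))

theorem lmarginal_comp_prod_insert (ρ : ∀ i, Ω i → ℝ) (g : ℝ → ENNReal) {s : Finset ι} {j : ι}
    (hj : j ∉ s) (x : ∀ i, Ω i) :
    lmarginal μ s (fun x => g (∏ i ∈ insert j s, ρ i (x i))) x =
      lmarginal μ s (fun y => g (ρ j (x j) * ∏ i ∈ s, ρ i (y i))) x := by
  refine lintegral_congr fun y => ?_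
  simp [Finset.prod_insert hj, Function.updateFinset, hj]

variable [∀ i, SigmaFinite (μ i)]

theorem exists_lmarginal_prod_le (ρ : ∀ i, Ω i → ℝ) (hρ : ∀ i, Measurable (ρ i))
    (hρ0 : ∀ i x, 0 ≤ ρ i x) (hρ1 : ∀ i x, ρ i x ≤ 1) (M : Finset ι) (i₀ : ι)
    (hbase : ∃ C : ℝ, 0 < C ∧ ∀ N : ℝ, 0 ≤ N →
      ∫⁻ x, ENNReal.ofReal (1 / (1 + N * ρ i₀ x) ^ 2) ∂μ i₀ ≤ ENNReal.ofReal (C * (1 / (1 + N))))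
    (hM : ∀ i ∈ M, ∃ C : ℝ, 0 < C ∧ ∀ N : ℝ, 0 ≤ N →
      ∫⁻ x, ENNReal.ofReal (1 / (1 + N * ρ i x)) ∂μ i ≤
        ENNReal.ofReal (C * ((1 + Real.log (1 + N)) / (1 + N))))
    (hM' : ∀ i ∉ M, ∃ C : ℝ, 0 < C ∧ ∀ N : ℝ, 0 ≤ N →
      ∫⁻ x, ENNReal.ofReal (1 / (1 + N * ρ i x)) ∂μ i ≤ ENNReal.ofReal (C * (1 / (1 + N))))
    (s : Finset ι) (hs : i₀ ∉ s) :
    ∃ C : ℝ, 0 < C ∧ ∀ N : ℝ, 0 ≤ N → ∀ x,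
      lmarginal μ (insert i₀ s)
        (fun x => ENNReal.ofReal (1 / (1 + N * ∏ i ∈ insert i₀ s, ρ i (x i)) ^ 2)) x ≤
      ENNReal.ofReal (C * ((1 + Real.log (1 + N)) ^ (s.filter (· ∈ M)).card / (1 + N))) := by
  induction s using Finset.induction_on with
  | empty =>
    obtain ⟨C, hC, h⟩ := hbase
    refine ⟨C, hC, fun N hN x => ?_⟩
    simpa [lmarginal_singleton] using h N hN
  | insert j s hj ih =>
    have hne : j ≠ i₀ := fun h => hs (h ▸ Finset.mem_insert_self j s)
    have hj' : j ∉ insert i₀ s := by simp [hne, hj]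
    obtain ⟨C, hC, h⟩ := ih fun h => hs (Finset.mem_insert_of_mem h)
    have step : ∀ N : ℝ, 0 ≤ N → ∀ x,
        lmarginal μ (insert i₀ (insert j s)) (fun x => ENNReal.ofReal
          (1 / (1 + N * ∏ i ∈ insert i₀ (insert j s), ρ i (x i)) ^ 2)) x ≤
        ENNReal.ofReal (C * (1 + Real.log (1 + N)) ^ (s.filter (· ∈ M)).card) *
          ∫⁻ y, ENNReal.ofReal (1 / (1 + N * ρ j y)) ∂μ j := by
      intro N hN x
      rw [Finset.insert_comm, lmarginal_insert _ (by fun_prop) hj',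
        ← lintegral_const_mul _ (by fun_prop)]
      refine lintegral_mono fun y => ?_
      rw [lmarginal_comp_prod_insert μ ρ (fun t => ENNReal.ofReal (1 / (1 + N * t) ^ 2)) hj',
        Function.update_self]
      simp_rw [← mul_assoc]
      have hNy : 0 ≤ N * ρ j y := mul_nonneg hN (hρ0 j y)
      have hlog : 0 ≤ Real.log (1 + N * ρ j y) := Real.log_nonneg (by linarith)
      have hle : N * ρ j y ≤ N := mul_le_of_le_one_right hN (hρ1 j y)
      refine (h _ hNy _).trans ?_
      rw [← ENNReal.ofReal_mul (by
        have := Real.log_nonneg (show 1 ≤ 1 + N by linarith)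
        positivity)]
      apply ENNReal.ofReal_le_ofReal
      rw [mul_assoc, mul_one_div]
      gcongr
    by_cases hjM : j ∈ M
    · obtain ⟨C', hC', h'⟩ := hM j hjM
      refine ⟨C * C', by positivity, fun N hN x => (step N hN x).trans ?_⟩
      have hlog : 0 ≤ Real.log (1 + N) := Real.log_nonneg (by linarith)
      grw [h' N hN]
      rw [← ENNReal.ofReal_mul (by positivity), Finset.filter_insert, if_pos hjM,
        Finset.card_insert_of_notMem (by simp [hj])]
      apply ENNReal.ofReal_le_ofReal (le_of_eq _)
      ring
    · obtain ⟨C', hC', h'⟩ := hM' j hjM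
      refine ⟨C * C', by positivity, fun N hN x => (step N hN x).trans ?_⟩
      have hlog : 0 ≤ Real.log (1 + N) := Real.log_nonneg (by linarith)
      grw [h' N hN]
      rw [← ENNReal.ofReal_mul (by positivity), Finset.filter_insert, if_neg hjM]
      apply ENNReal.ofReal_le_ofReal (le_of_eq _)
      ring

theorem exists_le_lmarginal_prod (ρ : ∀ i, Ω i → ℝ) (hρ : ∀ i, Measurable (ρ i))
    (hρ0 : ∀ i x, 0 ≤ ρ i x) (M : Finset ι) (i₀ : ι)
    (hbase : ∃ c : ℝ, 0 < c ∧ ∀ N : ℝ, 0 ≤ N → ENNReal.ofReal (c * (1 / (1 + N))) ≤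
      ∫⁻ x, ENNReal.ofReal (if N * ρ i₀ x ≤ 1 then 1 else 0) ∂μ i₀)
    (hM : ∀ i ∈ M, ∀ K : ℕ, ∃ c : ℝ, 0 < c ∧ ∀ N : ℝ, 0 ≤ N →
      ENNReal.ofReal (c * (Real.log (1 + N) ^ (K + 1) / (1 + N))) ≤
      ∫⁻ x, ENNReal.ofReal (Real.log (1 + N * ρ i x) ^ K / (1 + N * ρ i x)) ∂μ i)
    (hM' : ∀ i ∉ M, ∀ K : ℕ, ∃ c : ℝ, 0 < c ∧ ∀ N : ℝ, 0 ≤ N →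
      ENNReal.ofReal (c * (Real.log (1 + N) ^ K / (1 + N))) ≤
      ∫⁻ x, ENNReal.ofReal (Real.log (1 + N * ρ i x) ^ K / (1 + N * ρ i x)) ∂μ i)
    (s : Finset ι) (hs : i₀ ∉ s) :
    ∃ c : ℝ, 0 < c ∧ ∀ N : ℝ, 0 ≤ N → ∀ x,
      ENNReal.ofReal (c * (Real.log (1 + N) ^ (s.filter (· ∈ M)).card / (1 + N))) ≤
      lmarginal μ (insert i₀ s)
        (fun x => ENNReal.ofReal (if N * ∏ i ∈ insert i₀ s, ρ i (x i) ≤ 1 then 1 else 0)) x := by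
  have hmeas : ∀ (N : ℝ) (T : Finset ι), Measurable fun x : ∀ i, Ω i =>
      ENNReal.ofReal (if N * ∏ i ∈ T, ρ i (x i) ≤ 1 then 1 else 0) := fun N T =>
    ENNReal.measurable_ofReal.comp
      (Measurable.ite (measurableSet_le (by fun_prop) (by fun_prop)) (by fun_prop) (by fun_prop))
  induction s using Finset.induction_on with
  | empty =>
    obtain ⟨C, hC, h⟩ := hbase
    refine ⟨C, hC, fun N hN x => ?_⟩
    simpa [lmarginal_singleton] using h N hN
  | insert j s hj ih =>
    have hne : j ≠ i₀ := fun h => hs (h ▸ Finset.mem_insert_self j s)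
    have hj' : j ∉ insert i₀ s := by simp [hne, hj]
    obtain ⟨c, hc, h⟩ := ih fun h => hs (Finset.mem_insert_of_mem h)
    have step : ∀ N : ℝ, 0 ≤ N → ∀ x,
        ENNReal.ofReal c * ∫⁻ y, ENNReal.ofReal
          (Real.log (1 + N * ρ j y) ^ (s.filter (· ∈ M)).card / (1 + N * ρ j y)) ∂μ j ≤
        lmarginal μ (insert i₀ (insert j s)) (fun x => ENNReal.ofReal
          (if N * ∏ i ∈ insert i₀ (insert j s), ρ i (x i) ≤ 1 then 1 else 0)) x := by
      intro N hN x
      rw [Finset.insert_comm, lmarginal_insert _ (hmeas N _) hj',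
        ← lintegral_const_mul _ (by fun_prop)]
      refine lintegral_mono fun y => ?_
      rw [lmarginal_comp_prod_insert μ ρ
        (fun t => ENNReal.ofReal (if N * t ≤ 1 then 1 else 0)) hj', Function.update_self]
      simp_rw [← mul_assoc]
      rw [← ENNReal.ofReal_mul hc.le]
      exact h _ (mul_nonneg hN (hρ0 j y)) _
    by_cases hjM : j ∈ M
    · obtain ⟨c', hc', h'⟩ := hM j hjM (s.filter (· ∈ M)).card
      refine ⟨c * c', by positivity, fun N hN x => le_trans ?_ (step N hN x)⟩
      grw [← h' N hN]
      rw [← ENNReal.ofReal_mul hc.le, Finset.filter_insert, if_pos hjM,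
        Finset.card_insert_of_notMem (by simp [hj]), mul_assoc]
    · obtain ⟨c', hc', h'⟩ := hM' j hjM (s.filter (· ∈ M)).card
      refine ⟨c * c', by positivity, fun N hN x => le_trans ?_ (step N hN x)⟩
      grw [← h' N hN]
      rw [← ENNReal.ofReal_mul hc.le, Finset.filter_insert, if_neg hjM, mul_assoc]

end ProductIntegrals

/-- The distance of a point of the unit ball to the boundary sphere, extended by zero. -/
def ballDepth {d : ℕ} (x : EuclideanSpace ℝ (Fin d)) : ℝ := max 0 (1 - ‖x‖)

theorem measurable_ballDepth {d : ℕ} : Measurable (ballDepth (d := d)) := by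
  unfold ballDepth
  fun_prop

theorem ballDepth_nonneg {d : ℕ} (x : EuclideanSpace ℝ (Fin d)) : 0 ≤ ballDepth x :=
  le_max_left _ _

theorem ballDepth_le_one {d : ℕ} (x : EuclideanSpace ℝ (Fin d)) : ballDepth x ≤ 1 :=
  max_le zero_le_one (by linarith [norm_nonneg x])

theorem ballDepth_of_mem {d : ℕ} {x : EuclideanSpace ℝ (Fin d)}
    (hx : x ∈ Metric.closedBall (0 : EuclideanSpace ℝ (Fin d)) 1) : ballDepth x = 1 - ‖x‖ :=
  max_eq_right (by simpa using hx)

theorem exists_setLIntegral_ballDepth_le (d : ℕ) (hd : 1 ≤ d) :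
    ∃ κ : ℝ, 0 < κ ∧ ∀ f : ℝ → ENNReal, Measurable f →
      ∫⁻ x in Metric.closedBall (0 : EuclideanSpace ℝ (Fin d)) 1, f (ballDepth x) ≤
        ENNReal.ofReal κ * ∫⁻ t in Set.Ioc (0 : ℝ) 1, f t := by
  obtain ⟨κ, hκ, h⟩ := exists_setLIntegral_closedBall_le d hd
  refine ⟨κ, hκ, fun f hf => (le_of_eq ?_).trans (h f hf)⟩
  exact setLIntegral_congr_fun Metric.isClosed_closedBall.measurableSet
    fun x hx => by rw [ballDepth_of_mem hx]

theorem exists_le_setLIntegral_ballDepth (d : ℕ) (hd : 1 ≤ d) :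
    ∃ κ : ℝ, 0 < κ ∧ ∀ f : ℝ → ENNReal, Measurable f →
      ENNReal.ofReal κ * ∫⁻ t in Set.Ioc (0 : ℝ) (1 / 2), f t ≤
      ∫⁻ x in Metric.closedBall (0 : EuclideanSpace ℝ (Fin d)) 1, f (ballDepth x) := by
  obtain ⟨κ, hκ, h⟩ := exists_le_setLIntegral_closedBall d hd
  refine ⟨κ, hκ, fun f hf => (h f hf).trans (le_of_eq ?_)⟩
  exact setLIntegral_congr_fun Metric.isClosed_closedBall.measurableSet
    fun x hx => by rw [ballDepth_of_mem hx]

theorem volume_restrict_prodOfBalls {m : ℕ} (dv : Fin m → ℕ) :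
    (volume : Measure (Π i, EuclideanSpace ℝ (Fin (dv i)))).restrict (prodOfBalls dv) =
      Measure.pi fun i =>
        volume.restrict (Metric.closedBall (0 : EuclideanSpace ℝ (Fin (dv i))) 1) := by
  rw [prodOfBalls, volume_pi, Measure.restrict_pi_pi]

theorem setLIntegral_prodOfBalls_eq_lmarginal {m : ℕ} (dv : Fin m → ℕ) (i₀ : Fin m)
    (f : (Π i, EuclideanSpace ℝ (Fin (dv i))) → ENNReal) :
    ∫⁻ x in prodOfBalls dv, f x =
      lmarginal (fun i =>
        volume.restrict (Metric.closedBall (0 : EuclideanSpace ℝ (Fin (dv i))) 1))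
        (insert i₀ (Finset.univ.erase i₀)) f 0 := by
  rw [Finset.insert_erase (Finset.mem_univ _), lmarginal_univ, volume_restrict_prodOfBalls]

theorem card_filter_univ_erase {m : ℕ} (p : Fin m → Prop) [DecidablePred p] (i₀ : Fin m)
    (h : p i₀) :
    ((Finset.univ.erase i₀).filter (· ∈ Finset.univ.filter p)).card =
      (Finset.univ.filter p).card - 1 := by
  rw [← Finset.card_erase_of_mem (s := Finset.univ.filter p) (by simpa using h)]
  congr 1
  ext i
  simp

/-- The product of the depths of the components, with the normalized exponents
`(d_i + 1) / (d_max + 1)`. -/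
def depthProd {m : ℕ} (dv : Fin m → ℕ) (dmax : ℕ) (x : Π i, EuclideanSpace ℝ (Fin (dv i))) : ℝ :=
  ∏ i, ballDepth (x i) ^ (((dv i : ℝ) + 1) / (dmax + 1))

theorem exists_setLIntegral_depthProd_le {m : ℕ} {dv : Fin m → ℕ} (hdv : ∀ i, 1 ≤ dv i) {dmax : ℕ}
    (hdmax : IsGreatest (Set.range dv) dmax) :
    ∃ C : ℝ, 0 < C ∧ ∀ N : ℝ, 0 ≤ N →
      ∫⁻ x in prodOfBalls dv, ENNReal.ofReal (1 / (1 + N * depthProd dv dmax x) ^ 2) ≤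
        ENNReal.ofReal (C * ((1 + Real.log (1 + N)) ^
          ((Finset.univ.filter fun i => dv i = dmax).card - 1) / (1 + N))) := by
  obtain ⟨i₀, hi₀⟩ := hdmax.1
  have hrpos : ∀ i, 0 < ((dv i : ℝ) + 1) / (dmax + 1) := fun i => by positivity
  have hr1 : ∀ i, dv i = dmax → ((dv i : ℝ) + 1) / (dmax + 1) = 1 := fun i hi => by
    rw [hi, div_self (by positivity)]
  have hrlt : ∀ i, dv i ≠ dmax → ((dv i : ℝ) + 1) / (dmax + 1) < 1 := fun i hi => by
    have : dv i < dmax := lt_of_le_of_ne (hdmax.2 ⟨i, rfl⟩) hi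
    rw [div_lt_one (by positivity)]
    exact_mod_cast Nat.succ_lt_succ this
  have main := exists_lmarginal_prod_le
    (fun i => volume.restrict (Metric.closedBall (0 : EuclideanSpace ℝ (Fin (dv i))) 1))
    (fun i x => ballDepth x ^ (((dv i : ℝ) + 1) / (dmax + 1)))
    (fun i => measurable_ballDepth.pow_const _)
    (fun i x => Real.rpow_nonneg (ballDepth_nonneg x) _)
    (fun i x => Real.rpow_le_one (ballDepth_nonneg x) (ballDepth_le_one x) (hrpos i).le)
    (Finset.univ.filter fun i => dv i = dmax) i₀ ?_ ?_ ?_ (Finset.univ.erase i₀) (by simp)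
  · rw [card_filter_univ_erase _ _ hi₀] at main
    obtain ⟨C, hC, h⟩ := main
    refine ⟨C, hC, fun N hN => ?_⟩
    rw [setLIntegral_prodOfBalls_eq_lmarginal dv i₀]
    refine (le_of_eq ?_).trans (h N hN 0)
    rw [Finset.insert_erase (Finset.mem_univ _)]
    rfl
  · obtain ⟨κ, hκ, h⟩ := exists_setLIntegral_ballDepth_le (dv i₀) (hdv i₀)
    refine ⟨κ, hκ, fun N hN => ?_⟩
    rw [ENNReal.ofReal_mul hκ.le, ← setLIntegral_inv_one_add_mul_sq N hN]
    simp only [hr1 i₀ hi₀, Real.rpow_one]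
    exact h (fun t => ENNReal.ofReal (1 / (1 + N * t) ^ 2)) (by fun_prop)
  · intro i hi
    obtain ⟨κ, hκ, h⟩ := exists_setLIntegral_ballDepth_le (dv i) (hdv i)
    refine ⟨κ, hκ, fun N hN => ?_⟩
    grw [ENNReal.ofReal_mul hκ.le, ← setLIntegral_inv_one_add_mul_le N hN]
    simp only [hr1 i (by simpa using hi), Real.rpow_one]
    exact h (fun t => ENNReal.ofReal (1 / (1 + N * t))) (by fun_prop)
  · intro i hi
    obtain ⟨κ, hκ, h⟩ := exists_setLIntegral_ballDepth_le (dv i) (hdv i)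
    have hlt := hrlt i (by simpa using hi)
    have hlt' := sub_pos.2 hlt
    refine ⟨κ * (1 / (1 - ((dv i : ℝ) + 1) / (dmax + 1))), by positivity, fun N hN => ?_⟩
    grw [mul_assoc, mul_one_div, ENNReal.ofReal_mul hκ.le,
      ← setLIntegral_inv_one_add_mul_rpow_le _ (hrpos i) hlt N hN]
    exact h (fun t => ENNReal.ofReal (1 / (1 + N * t ^ (((dv i : ℝ) + 1) / (dmax + 1)))))
      (by fun_prop)

theorem exists_le_setLIntegral_depthProd {m : ℕ} {dv : Fin m → ℕ} (hdv : ∀ i, 1 ≤ dv i) {dmax : ℕ}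
    (hdmax : IsGreatest (Set.range dv) dmax) :
    ∃ c : ℝ, 0 < c ∧ ∀ N : ℝ, 0 ≤ N →
      ENNReal.ofReal (c * (Real.log (1 + N) ^
          ((Finset.univ.filter fun i => dv i = dmax).card - 1) / (1 + N))) ≤
      ∫⁻ x in prodOfBalls dv,
        ENNReal.ofReal (if N * depthProd dv dmax x ≤ 1 then 1 else 0) := by
  obtain ⟨i₀, hi₀⟩ := hdmax.1
  have main := exists_le_lmarginal_prod
    (fun i => volume.restrict (Metric.closedBall (0 : EuclideanSpace ℝ (Fin (dv i))) 1))
    (fun i x => if dv i = dmax then ballDepth x else 1)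
    (fun i => Measurable.ite (by simp) measurable_ballDepth measurable_const)
    (fun i x => by split_ifs <;> simp [ballDepth_nonneg])
    (Finset.univ.filter fun i => dv i = dmax) i₀ ?_ ?_ ?_ (Finset.univ.erase i₀) (by simp)
  · rw [card_filter_univ_erase _ _ hi₀] at main
    obtain ⟨c, hc, h⟩ := main
    refine ⟨c, hc, fun N hN => ?_⟩
    rw [setLIntegral_prodOfBalls_eq_lmarginal dv i₀]
    refine (h N hN 0).trans (lmarginal_mono (fun x => ENNReal.ofReal_le_ofReal ?_) 0)
    rw [Finset.insert_erase (Finset.mem_univ _)]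
    have hle : depthProd dv dmax x ≤ ∏ i, (if dv i = dmax then ballDepth (x i) else 1) := by
      refine Finset.prod_le_prod (fun i _ => Real.rpow_nonneg (ballDepth_nonneg _) _)
        fun i _ => ?_
      split_ifs with hi
      · rw [show ((dv i : ℝ) + 1) / (dmax + 1) = 1 by rw [hi, div_self (by positivity)],
          Real.rpow_one]
      · exact Real.rpow_le_one (ballDepth_nonneg _) (ballDepth_le_one _) (by positivity)
    split_ifs with h1 h2 h2
    · exact le_rfl
    · exact absurd ((mul_le_mul_of_nonneg_left hle hN).trans h1) h2
    · exact zero_le_one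
    · exact le_rfl
  · obtain ⟨κ, hκ, h⟩ := exists_le_setLIntegral_ballDepth (dv i₀) (hdv i₀)
    refine ⟨κ * (1 / 2), by positivity, fun N hN => ?_⟩
    grw [mul_assoc, mul_one_div, ENNReal.ofReal_mul hκ.le, le_setLIntegral_indicator N hN]
    simp only [hi₀, if_true]
    exact h (fun t => ENNReal.ofReal (if N * t ≤ 1 then 1 else 0))
      (ENNReal.measurable_ofReal.comp (Measurable.ite
        (measurableSet_le (by fun_prop) (by fun_prop)) (by fun_prop) (by fun_prop)))
  · intro i hi K
    obtain ⟨κ, hκ, h⟩ := exists_le_setLIntegral_ballDepth (dv i) (hdv i)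
    refine ⟨κ * (1 / (2 ^ (K + 1) * (K + 1))), by positivity, fun N hN => ?_⟩
    grw [mul_assoc, ENNReal.ofReal_mul hκ.le, le_setLIntegral_log_pow_div K N hN]
    rw [Finset.mem_filter] at hi
    simp only [hi.2, if_true]
    exact h (fun t => ENNReal.ofReal (Real.log (1 + N * t) ^ K / (1 + N * t))) (by fun_prop)
  · intro i hi K
    have hpos : 0 < volume (Metric.closedBall (0 : EuclideanSpace ℝ (Fin (dv i))) 1) :=
      Metric.measure_closedBall_pos _ _ zero_lt_one
    have hfin : volume (Metric.closedBall (0 : EuclideanSpace ℝ (Fin (dv i))) 1) ≠ ⊤ :=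
      measure_closedBall_lt_top.ne
    refine ⟨(volume (Metric.closedBall (0 : EuclideanSpace ℝ (Fin (dv i))) 1)).toReal,
      ENNReal.toReal_pos hpos.ne' hfin, fun N hN => ?_⟩
    rw [ENNReal.ofReal_mul ENNReal.toReal_nonneg, ENNReal.ofReal_toReal hfin]
    rw [Finset.mem_filter, not_and] at hi
    simp [hi, mul_comm]

theorem exists_orthonormalBasis_eq_norm_smul {d : ℕ} (j₀ : Fin d)
    (x : EuclideanSpace ℝ (Fin d)) :
    ∃ b : OrthonormalBasis (Fin d) ℝ (EuclideanSpace ℝ (Fin d)), x = ‖x‖ • b j₀ := by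
  obtain ⟨u, hu, hxu⟩ : ∃ u : EuclideanSpace ℝ (Fin d), ‖u‖ = 1 ∧ x = ‖x‖ • u := by
    by_cases hx : x = 0
    · exact ⟨EuclideanSpace.single j₀ 1, by simp, by simp [hx]⟩
    · exact ⟨‖x‖⁻¹ • x, norm_smul_inv_norm hx, by simp [smul_smul, hx]⟩
  obtain ⟨b, hb⟩ := Orthonormal.exists_orthonormalBasis_extension_of_card_eq (𝕜 := ℝ)
    (E := EuclideanSpace ℝ (Fin d)) (ι := Fin d) (by simp) (v := fun _ => u) (s := {j₀}) (by
      rw [orthonormal_iff_ite]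
      rintro ⟨i, hi⟩ ⟨j, hj⟩
      rw [Set.mem_singleton_iff] at hi hj
      simp [hi, hj, hu])
  exact ⟨b, by rw [hb j₀ rfl]; exact hxu⟩

theorem volume_orthonormalBasis_box {d : ℕ}
    (b : OrthonormalBasis (Fin d) ℝ (EuclideanSpace ℝ (Fin d)))
    (x : EuclideanSpace ℝ (Fin d)) (l h : Fin d → ℝ) :
    MeasurableSet {y | ∀ j, b.repr (y - x) j ∈ Set.Icc (l j) (h j)} ∧
    volume {y | ∀ j, b.repr (y - x) j ∈ Set.Icc (l j) (h j)} =
      ∏ j, ENNReal.ofReal (h j - l j) := by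
  have hmp := ((PiLp.volume_preserving_ofLp (Fin d)).comp
    b.measurePreserving_repr).comp (measurePreserving_sub_right volume x)
  have hset : {y | ∀ j, b.repr (y - x) j ∈ Set.Icc (l j) (h j)} =
      (WithLp.ofLp ∘ b.repr ∘ fun y => y - x) ⁻¹' Set.univ.pi fun j => Set.Icc (l j) (h j) := by
    ext y
    simp only [Set.mem_ofPred_eq, Set.mem_preimage, Set.mem_univ_pi, Function.comp]
  have hm : MeasurableSet (Set.univ.pi fun j => Set.Icc (l j) (h j)) :=
    MeasurableSet.univ_pi fun j => measurableSet_Icc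
  rw [hset]
  refine ⟨hmp.measurable hm, ?_⟩
  rw [← Function.comp_assoc, hmp.measure_preimage hm.nullMeasurableSet, volume_pi_pi]
  simp

theorem prod_ite_sqrt_mul {d : ℕ} (j₀ : Fin d) (c s : ℝ) (hc : 0 ≤ c) (hs : 0 ≤ s) :
    ∏ j : Fin d, ENNReal.ofReal (c * if j = j₀ then s else √s) =
      ENNReal.ofReal (c ^ d * s ^ (((d : ℝ) + 1) / 2)) := by
  rw [← ENNReal.ofReal_prod_of_nonneg fun j _ => by split_ifs <;> positivity]
  congr 1
  rw [Finset.prod_mul_distrib, ← Finset.mul_prod_erase Finset.univ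
      (fun j => if j = j₀ then s else √s) (Finset.mem_univ j₀),
    Finset.prod_congr (s₁ := Finset.univ.erase j₀) rfl
      fun j hj => if_neg (Finset.ne_of_mem_erase hj)]
  have hd : 0 < d := j₀.pos
  simp only [Finset.prod_const, Finset.card_univ, Fintype.card_fin, if_true,
    Finset.card_erase_of_mem (Finset.mem_univ j₀)]
  congr 1
  rcases hs.eq_or_lt with rfl | hs
  · rw [Real.zero_rpow (by positivity), zero_mul]
  · rw [Real.sqrt_eq_rpow, ← Real.rpow_natCast, ← Real.rpow_mul hs.le]
    nth_rewrite 1 [← Real.rpow_one s]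
    rw [← Real.rpow_add hs]
    congr 1
    rw [Nat.cast_sub hd]
    push_cast
    ring

theorem norm_sq_eq_sum_repr_sq {d : ℕ}
    (b : OrthonormalBasis (Fin d) ℝ (EuclideanSpace ℝ (Fin d)))
    (y : EuclideanSpace ℝ (Fin d)) : ‖y‖ ^ 2 = ∑ j, b.repr y j ^ 2 := by
  rw [← b.repr.norm_map y, EuclideanSpace.norm_sq_eq]
  simp

theorem repr_of_eq_norm_smul {d : ℕ} {j₀ : Fin d}
    {b : OrthonormalBasis (Fin d) ℝ (EuclideanSpace ℝ (Fin d))}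
    {x : EuclideanSpace ℝ (Fin d)} (hx : x = ‖x‖ • b j₀) (j : Fin d) :
    b.repr x j = if j = j₀ then ‖x‖ else 0 := by
  nth_rewrite 1 [hx]
  simp [b.repr_self]

/-- Around each point of the ball there are orthant-like boxes inside the ball such that every
closed half-space through the point contains one of them. -/
theorem exists_boxes_subset_closedBall (d : ℕ) (hd : 1 ≤ d) :
    ∃ c : ℝ, 0 < c ∧ ∀ x ∈ Metric.closedBall (0 : EuclideanSpace ℝ (Fin d)) 1,
      ∃ A : (Fin d → Bool) → Set (EuclideanSpace ℝ (Fin d)),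
        (∀ σ, MeasurableSet (A σ)) ∧
        (∀ σ, A σ ⊆ Metric.closedBall 0 1) ∧
        (∀ σ, ENNReal.ofReal (c * ballDepth x ^ (((d : ℝ) + 1) / 2)) ≤ volume (A σ)) ∧
        ∀ a : EuclideanSpace ℝ (Fin d) →ₗ[ℝ] ℝ, ∃ σ, ∀ y ∈ A σ, 0 ≤ a (y - x) := by
  let j₀ : Fin d := ⟨0, hd⟩
  have hd' : (1 : ℝ) ≤ d := by exact_mod_cast hd
  set c : ℝ := 1 / (2 * d) with hc_def
  have hc : 0 < c := by positivity
  have hcd : c * d = 1 / 2 := by rw [hc_def]; field_simp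
  have hc2 : c ≤ 1 / 2 := by nlinarith
  refine ⟨c ^ d, by positivity, fun x hx => ?_⟩
  obtain ⟨b, hb⟩ := exists_orthonormalBasis_eq_norm_smul j₀ x
  set s := ballDepth x with hs
  have hs0 : 0 ≤ s := ballDepth_nonneg x
  have hs1 : s ≤ 1 := ballDepth_le_one x
  have hxs : ‖x‖ = 1 - s := by rw [hs, ballDepth_of_mem hx]; ring
  let w : Fin d → ℝ := fun j => c * if j = j₀ then s else √s
  have hw : ∀ j, 0 ≤ w j := fun j => by
    dsimp only [w]
    split_ifs <;> positivity
  let A : (Fin d → Bool) → Set (EuclideanSpace ℝ (Fin d)) := fun σ =>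
    {y | ∀ j, b.repr (y - x) j ∈
      Set.Icc (if σ j then 0 else - w j) (if σ j then w j else 0)}
  have hA : ∀ σ, ∀ y ∈ A σ, ∀ j, |b.repr (y - x) j| ≤ w j := fun σ y hy j => by
    have h1 := hy j
    have h2 := hw j
    rw [abs_le]
    cases hσ : σ j <;> simp only [hσ, if_true, if_false, Set.mem_Icc, Bool.false_eq_true] at h1
    · exact ⟨h1.1, h1.2.trans h2⟩
    · exact ⟨by linarith [h1.1], h1.2⟩
  refine ⟨A, fun σ => (volume_orthonormalBasis_box b x _ _).1, fun σ y hy => ?_, fun σ => ?_,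
    fun a => ⟨fun j => decide (0 ≤ a (b j)), fun y hy => ?_⟩⟩
  · have hrepr : ∀ j, b.repr y j = b.repr (y - x) j + if j = j₀ then ‖x‖ else 0 := fun j => by
      rw [← repr_of_eq_norm_smul hb j]
      simp
    have hbound : ∀ j, b.repr y j ^ 2 ≤ c ^ 2 * s + if j = j₀ then (1 - s + c * s) ^ 2 else 0 := by
      intro j
      have h1 := hA σ y hy j
      rw [hrepr]
      by_cases hj : j = j₀
      · simp only [hj, if_true] at h1 ⊢
        simp only [w, if_true] at h1
        have h2 : (b.repr (y - x) j₀ + ‖x‖) ^ 2 ≤ (1 - s + c * s) ^ 2 := by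
          apply sq_le_sq'
          · rw [abs_le] at h1
            have := mul_nonneg hc.le hs0
            linarith [h1.1]
          · rw [abs_le] at h1
            linarith [h1.2]
        have : 0 ≤ c ^ 2 * s := by positivity
        linarith
      · simp only [w, hj, if_false, add_zero] at h1 ⊢
        have h2 := sq_le_sq' (abs_le.1 h1).1 (abs_le.1 h1).2
        rwa [mul_pow, Real.sq_sqrt hs0] at h2
    rw [mem_closedBall_zero_iff]
    have hsum : ‖y‖ ^ 2 ≤ d * (c ^ 2 * s) + (1 - s + c * s) ^ 2 := by
      rw [norm_sq_eq_sum_repr_sq b]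
      refine (Finset.sum_le_sum fun j _ => hbound j).trans (le_of_eq ?_)
      simp [Finset.sum_add_distrib]
    have h3 : d * (c ^ 2 * s) = 1 / 2 * (c * s) := by
      rw [← hcd]; ring
    have h4 : 0 ≤ c * s := by positivity
    have h5 : c * s ≤ 1 / 2 * s := mul_le_mul_of_nonneg_right hc2 hs0
    have : ‖y‖ ^ 2 ≤ 1 ^ 2 := by nlinarith
    exact le_of_sq_le_sq this zero_le_one
  · rw [(volume_orthonormalBasis_box b x _ _).2, ← prod_ite_sqrt_mul j₀ c s hc.le hs0]
    refine le_of_eq (Finset.prod_congr rfl fun j _ => ?_)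
    congr 1
    cases σ j <;> simp [w]
  · rw [← b.sum_repr (y - x), map_sum]
    refine Finset.sum_nonneg fun j _ => ?_
    rw [map_smul, smul_eq_mul]
    have h1 := hy j
    by_cases hj : 0 ≤ a (b j)
    · simp only [hj, decide_true, if_true, Set.mem_Icc] at h1
      exact mul_nonneg h1.1 hj
    · simp only [hj, decide_false, if_false, Set.mem_Icc, Bool.false_eq_true] at h1
      exact mul_nonneg_of_nonpos_of_nonpos h1.2 (not_le.1 hj).le

/-- Spherical caps of height proportional to the depth of a point of the ball. -/
theorem exists_volume_cap_le (d : ℕ) (hd : 1 ≤ d) (L : ℝ) (hL : 0 ≤ L) :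
    ∃ C : ℝ, 0 < C ∧ ∀ x ∈ Metric.closedBall (0 : EuclideanSpace ℝ (Fin d)) 1,
      ∃ u : EuclideanSpace ℝ (Fin d), ‖u‖ = 1 ∧ 1 - inner ℝ u x = ballDepth x ∧
        volume {y ∈ Metric.closedBall (0 : EuclideanSpace ℝ (Fin d)) 1 |
          1 - inner ℝ u y ≤ L * ballDepth x} ≤
        ENNReal.ofReal (C * ballDepth x ^ (((d : ℝ) + 1) / 2)) := by
  let j₀ : Fin d := ⟨0, hd⟩
  set K : ℝ := 2 * (1 + 2 * L) with hK_def
  have hK : 0 < K := by positivity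
  refine ⟨K ^ d, by positivity, fun x hx => ?_⟩
  obtain ⟨b, hb⟩ := exists_orthonormalBasis_eq_norm_smul j₀ x
  set s := ballDepth x with hs
  have hs0 : 0 ≤ s := ballDepth_nonneg x
  have hxs : ‖x‖ = 1 - s := by rw [hs, ballDepth_of_mem hx]; ring
  refine ⟨b j₀, b.orthonormal.1 j₀, ?_, ?_⟩
  · rw [← b.repr_apply_apply, repr_of_eq_norm_smul hb, if_pos rfl, hxs]
    ring
  let l : Fin d → ℝ := fun j => if j = j₀ then 1 - K * s else -(K / 2 * √s)
  let h : Fin d → ℝ := fun j => if j = j₀ then 1 else K / 2 * √s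
  have hsub : {y ∈ Metric.closedBall (0 : EuclideanSpace ℝ (Fin d)) 1 |
      1 - inner ℝ (b j₀) y ≤ L * s} ⊆ {y | ∀ j, b.repr (y - 0) j ∈ Set.Icc (l j) (h j)} := by
    rintro y ⟨hy, hcap⟩ j
    rw [mem_closedBall_zero_iff] at hy
    rw [← b.repr_apply_apply] at hcap
    rw [sub_zero]
    have hsum : ∑ j, b.repr y j ^ 2 ≤ 1 := by
      rw [← norm_sq_eq_sum_repr_sq b]
      exact pow_le_one₀ (norm_nonneg _) hy
    have hj0 : b.repr y j₀ ^ 2 ≤ 1 :=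
      (Finset.single_le_sum (f := fun j => b.repr y j ^ 2) (fun j _ => sq_nonneg _)
        (Finset.mem_univ j₀)).trans hsum
    have hj01 := abs_le.1 ((sq_le_one_iff_abs_le_one _).1 hj0)
    by_cases hj : j = j₀
    · simp only [l, h, hj, if_true]
      refine ⟨?_, hj01.2⟩
      nlinarith
    · simp only [l, h, hj, if_false]
      have h2 : b.repr y j₀ ^ 2 + b.repr y j ^ 2 ≤ 1 := by
        rw [← Finset.sum_pair (f := fun j => b.repr y j ^ 2) (Ne.symm hj)]
        exact (Finset.sum_le_sum_of_subset_of_nonneg (Finset.subset_univ _)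
          fun j _ _ => sq_nonneg _).trans hsum
      have h3 : b.repr y j ^ 2 ≤ (K / 2 * √s) ^ 2 := by
        rw [mul_pow, Real.sq_sqrt hs0]
        have h4 : b.repr y j ^ 2 ≤ 2 * (L * s) := by nlinarith
        have h5 : 2 * L ≤ (K / 2) ^ 2 := by rw [hK_def]; nlinarith
        nlinarith
      exact abs_le.1 (abs_le_of_sq_le_sq h3 (by positivity))
  refine (measure_mono hsub).trans ?_
  rw [(volume_orthonormalBasis_box b 0 _ _).2, ← prod_ite_sqrt_mul j₀ K s hK.le hs0]
  refine le_of_eq (Finset.prod_congr rfl fun j _ => ?_)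
  congr 1
  by_cases hj : j = j₀
  · simp [l, h, hj]
  · simp only [l, h, hj, if_false]
    ring

theorem isClosed_setOf_mem_convexHull_range {E : Type*} [NormedAddCommGroup E] [NormedSpace ℝ E]
    (n : ℕ) : IsClosed {p : E × (Fin n → E) | p.1 ∈ convexHull ℝ (Set.range p.2)} := by
  have h : {p : E × (Fin n → E) | p.1 ∈ convexHull ℝ (Set.range p.2)} = Prod.snd ''
      {q : stdSimplex ℝ (Fin n) × (E × (Fin n → E)) | ∑ k, q.1.1 k • q.2.2 k = q.2.1} := by
    ext p
    simp only [Set.mem_ofPred_eq, Set.mem_image, Prod.exists, exists_eq_right]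
    constructor
    · intro hp
      rw [convexHull_range_eq_exists_affineCombination] at hp
      obtain ⟨s, w, hw0, hw1, hp⟩ := hp
      refine ⟨⟨fun k => if k ∈ s then w k else 0, fun k => ?_, ?_⟩, ?_⟩
      · dsimp only
        split_ifs with hk
        exacts [hw0 k hk, le_rfl]
      · simpa using hw1
      · rw [Finset.affineCombination_eq_linear_combination _ _ _ hw1] at hp
        simpa [ite_smul] using hp
    · rintro ⟨w, hw⟩
      rw [← hw]
      exact (convex_convexHull ℝ _).sum_mem (fun k _ => w.2.1 k) w.2.2
        fun k _ => subset_convexHull ℝ _ (Set.mem_range_self k)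
  rw [h]
  refine isClosedMap_snd_of_compactSpace _ (isClosed_eq ?_ (by fun_prop))
  refine continuous_finsetSum _ fun k _ => Continuous.smul ?_ (by fun_prop)
  exact (continuous_apply k).comp (continuous_subtype_val.comp continuous_fst)

theorem ae_convexHull_range_subset {E : Type*} [AddCommGroup E] [Module ℝ E]
    [MeasurableSpace E] {μ : Measure E} [IsProbabilityMeasure μ] {Z : Set E} (hZ : Convex ℝ Z)
    (hμZ : ∀ᵐ x ∂μ, x ∈ Z) (n : ℕ) :
    ∀ᵐ X ∂(Measure.pi fun _ : Fin n => μ), convexHull ℝ (Set.range X) ⊆ Z := by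
  have h : ∀ᵐ X ∂(Measure.pi fun _ : Fin n => μ), ∀ k, X k ∈ Z :=
    ae_all_iff.2 fun k => (measurePreserving_eval (fun _ : Fin n => μ) k).quasiMeasurePreserving.ae hμZ
  filter_upwards [h] with X hX
  exact convexHull_min (Set.range_subset_iff.2 hX) hZ

theorem sub_integral_measure_convexHull {E : Type*} [NormedAddCommGroup E] [NormedSpace ℝ E]
    [SecondCountableTopology E] [MeasurableSpace E] [BorelSpace E]
    {μ ν : Measure E} [IsProbabilityMeasure μ] {Z : Set E} (hZ : Convex ℝ Z)
    (hμZ : ∀ᵐ x ∂μ, x ∈ Z) (hνZ : ν Z ≠ ⊤) (n : ℕ) :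
    (ν Z).toReal - ∫ X, (ν (convexHull ℝ (Set.range X))).toReal ∂(Measure.pi fun _ : Fin n => μ) =
      (∫⁻ x in Z, (Measure.pi fun _ : Fin n => μ) {X | x ∉ convexHull ℝ (Set.range X)} ∂ν).toReal := by
  set P := Measure.pi fun _ : Fin n => μ
  have : IsFiniteMeasure (ν.restrict Z) := isFiniteMeasure_restrict.2 hνZ
  set H : Set (E × (Fin n → E)) := {p | p.1 ∈ convexHull ℝ (Set.range p.2)}
  have hH : MeasurableSet H := (isClosed_setOf_mem_convexHull_range n).measurableSet
  have hae : ∀ᵐ X ∂P, ν (convexHull ℝ (Set.range X)) = ν.restrict Z ((fun x => (x, X)) ⁻¹' H) := by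
    filter_upwards [ae_convexHull_range_subset hZ hμZ n] with X hX
    exact (Measure.restrict_eq_self ν hX).symm
  have h1 : ∫ X, (ν (convexHull ℝ (Set.range X))).toReal ∂P = ((ν.restrict Z).prod P H).toReal := by
    rw [integral_congr_ae (hae.mono fun X hX => congrArg ENNReal.toReal hX),
      integral_toReal (measurable_measure_prodMk_right hH).aemeasurable
        (ae_of_all _ fun X => measure_lt_top _ _), Measure.prod_apply_symm hH]
  have h2 : ∫⁻ x in Z, P {X | x ∉ convexHull ℝ (Set.range X)} ∂ν = (ν.restrict Z).prod P Hᶜ := by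
    rw [Measure.prod_apply hH.compl]
    rfl
  have h3 : (ν Z).toReal = ((ν.restrict Z).prod P Set.univ).toReal := by
    rw [← Set.univ_prod_univ, Measure.prod_prod]
    simp
  rw [h1, h2, h3, ← measure_add_measure_compl hH, ENNReal.toReal_add (by finiteness) (by finiteness)]
  ring

/-- The convex hull of a sample misses a point only if the sample misses one of the sets of a
family that pierces every half-space through the point. -/
theorem measure_notMem_convexHull_le {E ι : Type*} [Fintype ι] [AddCommGroup E] [Module ℝ E]
    [MeasurableSpace E] {μ : Measure E} [IsProbabilityMeasure μ] {A : ι → Set E}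
    (hA : ∀ σ, MeasurableSet (A σ)) {q : ℝ} (hq : ∀ σ, ENNReal.ofReal q ≤ μ (A σ)) {x : E} {n : ℕ}
    (hx : ∀ X : Fin n → E, (∀ σ, ∃ k, X k ∈ A σ) → x ∈ convexHull ℝ (Set.range X)) :
    (Measure.pi fun _ : Fin n => μ) {X | x ∉ convexHull ℝ (Set.range X)} ≤
      ENNReal.ofReal (Fintype.card ι * Real.exp (-(n * q))) := by
  have hsub : {X : Fin n → E | x ∉ convexHull ℝ (Set.range X)} ⊆
      ⋃ σ, Set.univ.pi fun _ : Fin n => (A σ)ᶜ := by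
    intro X hX
    by_contra h
    simp only [Set.mem_iUnion, Set.mem_univ_pi, Set.mem_compl_iff, not_exists, not_forall,
      not_not] at h
    exact hX (hx X h)
  refine (measure_mono hsub).trans ((measure_iUnion_fintype_le _ _).trans ?_)
  have hterm : ∀ σ, (Measure.pi fun _ : Fin n => μ) (Set.univ.pi fun _ : Fin n => (A σ)ᶜ) ≤
      ENNReal.ofReal (Real.exp (-(n * q))) := by
    intro σ
    rw [Measure.pi_pi, Finset.prod_const, Finset.card_univ, Fintype.card_fin,
      prob_compl_eq_one_sub (hA σ)]
    have h1 : 1 - μ (A σ) ≤ ENNReal.ofReal (Real.exp (-q)) := by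
      refine (tsub_le_tsub_left (hq σ) 1).trans ?_
      rw [tsub_le_iff_right]
      refine le_trans (le_of_eq ENNReal.ofReal_one.symm) (le_trans
        (ENNReal.ofReal_le_ofReal ?_) ENNReal.ofReal_add_le)
      linarith [Real.add_one_le_exp (-q)]
    refine (pow_le_pow_left' h1 n).trans (le_of_eq ?_)
    rw [← ENNReal.ofReal_pow (Real.exp_nonneg _), ← Real.exp_nat_mul]
    congr 2
    ring
  refine (Finset.sum_le_sum fun σ _ => hterm σ).trans (le_of_eq ?_)
  rw [Finset.sum_const, Finset.card_univ, nsmul_eq_mul, ENNReal.ofReal_mul (by positivity),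
    ENNReal.ofReal_natCast]

/-- If a half-space through a point carries little mass, the convex hull of a sample misses the
point with sizeable probability. -/
theorem le_measure_notMem_convexHull {E : Type*} [AddCommGroup E] [Module ℝ E]
    [MeasurableSpace E] {μ : Measure E} [IsProbabilityMeasure μ] {H : Set E}
    (hH : MeasurableSet H) (hconv : Convex ℝ Hᶜ) {x : E} (hx : x ∈ H) {n : ℕ} (hn : 1 ≤ n)
    (hμ : μ H ≤ ENNReal.ofReal (1 / (2 * n))) :
    ENNReal.ofReal (1 / 2) ≤
      (Measure.pi fun _ : Fin n => μ) {X | x ∉ convexHull ℝ (Set.range X)} := by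
  have hn' : (1 : ℝ) ≤ n := by exact_mod_cast hn
  have hsub : (Set.univ.pi fun _ : Fin n => Hᶜ) ⊆ {X | x ∉ convexHull ℝ (Set.range X)} := by
    intro X hX hxX
    rw [Set.mem_univ_pi] at hX
    exact convexHull_min (Set.range_subset_iff.2 hX) hconv hxX hx
  refine le_trans ?_ (measure_mono hsub)
  rw [Measure.pi_pi, Finset.prod_const, Finset.card_univ, Fintype.card_fin, prob_compl_eq_one_sub hH]
  have h1 : ENNReal.ofReal (1 - 1 / (2 * n)) ≤ 1 - μ H := by
    rw [ENNReal.ofReal_sub _ (by positivity), ENNReal.ofReal_one]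
    exact tsub_le_tsub_left hμ 1
  have h2 : 1 / (2 * (n : ℝ)) ≤ 1 / 2 := by
    apply one_div_le_one_div_of_le <;> linarith
  refine le_trans ?_ (pow_le_pow_left' h1 n)
  rw [← ENNReal.ofReal_pow (by linarith)]
  refine ENNReal.ofReal_le_ofReal ?_
  have := one_add_mul_le_pow (a := -(1 / (2 * (n : ℝ)))) (by linarith) n
  have h3 : (n : ℝ) * (1 / (2 * n)) = 1 / 2 := by field_simp
  rw [← sub_eq_add_neg] at this
  linarith

theorem convex_prodOfBalls {m : ℕ} (dv : Fin m → ℕ) : Convex ℝ (prodOfBalls dv) :=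
  convex_pi fun _ _ => convex_closedBall 0 1

theorem measurableSet_prodOfBalls {m : ℕ} (dv : Fin m → ℕ) : MeasurableSet (prodOfBalls dv) :=
  MeasurableSet.univ_pi fun _ => measurableSet_closedBall

theorem volume_prodOfBalls_ne_top {m : ℕ} (dv : Fin m → ℕ) : volume (prodOfBalls dv) ≠ ⊤ :=
  (isCompact_univ_pi fun _ => isCompact_closedBall _ _).measure_ne_top

theorem volume_prodOfBalls_ne_zero {m : ℕ} (dv : Fin m → ℕ) : volume (prodOfBalls dv) ≠ 0 := by
  rw [prodOfBalls, volume_pi_pi]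
  exact Finset.prod_ne_zero_iff.2 fun i _ => (Metric.measure_closedBall_pos _ _ one_pos).ne'

theorem isProbabilityMeasure_uniformDist_prodOfBalls {m : ℕ} (dv : Fin m → ℕ) :
    IsProbabilityMeasure (uniformDist (prodOfBalls dv)) := by
  constructor
  rw [uniformDist, Measure.smul_apply, Measure.restrict_apply_univ, smul_eq_mul,
    ENNReal.inv_mul_cancel (volume_prodOfBalls_ne_zero dv) (volume_prodOfBalls_ne_top dv)]

theorem uniformDist_prodOfBalls_apply {m : ℕ} (dv : Fin m → ℕ)
    (A : Set (Π i, EuclideanSpace ℝ (Fin (dv i)))) :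
    uniformDist (prodOfBalls dv) A =
      ENNReal.ofReal (volume (prodOfBalls dv)).toReal⁻¹ * volume (A ∩ prodOfBalls dv) := by
  rw [uniformDist, Measure.smul_apply, Measure.restrict_apply' (measurableSet_prodOfBalls dv),
    smul_eq_mul, ENNReal.ofReal_inv_of_pos (ENNReal.toReal_pos (volume_prodOfBalls_ne_zero dv)
      (volume_prodOfBalls_ne_top dv)), ENNReal.ofReal_toReal (volume_prodOfBalls_ne_top dv)]

theorem toReal_volume_sub_expectedVolume {m : ℕ} (dv : Fin m → ℕ) (n : ℕ) :
    (volume (prodOfBalls dv)).toReal - expectedVolume dv n =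
      (∫⁻ x in prodOfBalls dv, (Measure.pi fun _ : Fin n => uniformDist (prodOfBalls dv))
        {X | x ∉ convexHull ℝ (Set.range X)}).toReal := by
  have := isProbabilityMeasure_uniformDist_prodOfBalls dv
  refine sub_integral_measure_convexHull (convex_prodOfBalls dv) ?_ (volume_prodOfBalls_ne_top dv) n
  exact Measure.ae_smul_measure (ae_restrict_mem (measurableSet_prodOfBalls dv)) _

theorem depthProd_nonneg {m : ℕ} (dv : Fin m → ℕ) (dmax : ℕ)
    (x : Π i, EuclideanSpace ℝ (Fin (dv i))) : 0 ≤ depthProd dv dmax x :=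
  Finset.prod_nonneg fun i _ => Real.rpow_nonneg (ballDepth_nonneg (x i)) _

theorem depthProd_rpow {m : ℕ} (dv : Fin m → ℕ) (dmax : ℕ)
    (x : Π i, EuclideanSpace ℝ (Fin (dv i))) :
    depthProd dv dmax x ^ (((dmax : ℝ) + 1) / 2) =
      ∏ i, ballDepth (x i) ^ (((dv i : ℝ) + 1) / 2) := by
  rw [depthProd, ← Real.finsetProd_rpow _ _
    fun i _ => Real.rpow_nonneg (ballDepth_nonneg (x i)) _]
  refine Finset.prod_congr rfl fun i _ => ?_
  rw [← Real.rpow_mul (ballDepth_nonneg (x i))]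
  congr 1
  field_simp

theorem prod_ofReal_mul_ballDepth {m : ℕ} (dv : Fin m → ℕ) (dmax : ℕ) {c : Fin m → ℝ}
    (hc : ∀ i, 0 < c i) (x : Π i, EuclideanSpace ℝ (Fin (dv i))) :
    ∏ i, ENNReal.ofReal (c i * ballDepth (x i) ^ (((dv i : ℝ) + 1) / 2)) =
      ENNReal.ofReal ((∏ i, c i) * depthProd dv dmax x ^ (((dmax : ℝ) + 1) / 2)) := by
  rw [depthProd_rpow, ← Finset.prod_mul_distrib, ENNReal.ofReal_prod_of_nonneg]
  exact fun i _ => mul_nonneg (hc i).le (Real.rpow_nonneg (ballDepth_nonneg (x i)) _)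

theorem exists_measure_notMem_convexHull_le {m : ℕ} {dv : Fin m → ℕ} (hdv : ∀ i, 1 ≤ dv i)
    (dmax : ℕ) :
    ∃ c : ℝ, 0 < c ∧ ∃ K : ℝ, 0 < K ∧ ∀ n : ℕ, ∀ x ∈ prodOfBalls dv,
      (Measure.pi fun _ : Fin n => uniformDist (prodOfBalls dv))
        {X | x ∉ convexHull ℝ (Set.range X)} ≤
      ENNReal.ofReal
        (K * Real.exp (-(n * (c * depthProd dv dmax x ^ (((dmax : ℝ) + 1) / 2))))) := by
  have := isProbabilityMeasure_uniformDist_prodOfBalls dv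
  choose c hc hbox using fun i => exists_boxes_subset_closedBall (dv i) (hdv i)
  have hV := ENNReal.toReal_pos (volume_prodOfBalls_ne_zero dv) (volume_prodOfBalls_ne_top dv)
  refine ⟨(volume (prodOfBalls dv)).toReal⁻¹ * ∏ i, c i,
    mul_pos (inv_pos.2 hV) (Finset.prod_pos fun i _ => hc i),
    Fintype.card (Π i, Fin (dv i) → Bool), by exact_mod_cast Fintype.card_pos,
    fun n x hx => ?_⟩
  choose A hmeas hsub hvol hhalf using fun i => hbox i (x i) (hx i (Set.mem_univ i))
  refine measure_notMem_convexHull_le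
    (A := fun σ : Π i, Fin (dv i) → Bool => Set.univ.pi fun i => A i (σ i))
    (fun σ => MeasurableSet.univ_pi fun i => hmeas i (σ i)) (fun σ => ?_) fun X hX => ?_
  · have hsubset : (Set.univ.pi fun i => A i (σ i)) ⊆ prodOfBalls dv :=
      Set.pi_mono fun i _ => hsub i (σ i)
    rw [uniformDist_prodOfBalls_apply, Set.inter_eq_left.2 hsubset, volume_pi_pi, mul_assoc,
      ENNReal.ofReal_mul (by positivity), ← prod_ofReal_mul_ballDepth dv dmax hc]
    gcongr with i
    exact hvol i (σ i)
  · by_contra hxX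
    obtain ⟨f, u, hfx, hfX⟩ := geometric_hahn_banach_point_closed (convex_convexHull ℝ _)
      ((Set.finite_range X).isClosed_convexHull ℝ) hxX
    choose σ hσ using fun i => hhalf i (-(f.toLinearMap ∘ₗ LinearMap.single ℝ _ i))
    obtain ⟨k, hk⟩ := hX σ
    have h1 := hfX (X k) (subset_convexHull ℝ _ (Set.mem_range_self k))
    have h2 : f (X k - x) = ∑ i, f (Pi.single i (X k i - x i)) := by
      rw [← map_sum]
      congr 1
      exact (Finset.univ_sum_single (X k - x)).symm
    have h3 : f (X k - x) ≤ 0 := by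
      rw [h2]
      refine Finset.sum_nonpos fun i _ => ?_
      have := hσ i (X k i) (hk i (Set.mem_univ i))
      simp only [LinearMap.neg_apply, LinearMap.comp_apply, LinearMap.single_apply] at this
      exact neg_nonneg.1 this
    rw [map_sub] at h3
    linarith

theorem exists_le_measure_notMem_convexHull {m : ℕ} {dv : Fin m → ℕ} (hdv : ∀ i, 1 ≤ dv i)
    (dmax : ℕ) :
    ∃ C : ℝ, 0 < C ∧ ∀ n : ℕ, 1 ≤ n → ∀ x ∈ prodOfBalls dv, (∀ i, 0 < ballDepth (x i)) →
      C * depthProd dv dmax x ^ (((dmax : ℝ) + 1) / 2) ≤ 1 / (2 * n) →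
      ENNReal.ofReal (1 / 2) ≤ (Measure.pi fun _ : Fin n => uniformDist (prodOfBalls dv))
        {X | x ∉ convexHull ℝ (Set.range X)} := by
  have := isProbabilityMeasure_uniformDist_prodOfBalls dv
  choose C hC hcap using fun i => exists_volume_cap_le (dv i) (hdv i) m (Nat.cast_nonneg m)
  have hV := ENNReal.toReal_pos (volume_prodOfBalls_ne_zero dv) (volume_prodOfBalls_ne_top dv)
  refine ⟨(volume (prodOfBalls dv)).toReal⁻¹ * ∏ i, C i,
    mul_pos (inv_pos.2 hV) (Finset.prod_pos fun i _ => hC i), fun n hn x hx hpos hsmall => ?_⟩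
  choose u hu1 hux hvol using fun i => hcap i (x i) (hx i (Set.mem_univ i))
  let g : (Π i, EuclideanSpace ℝ (Fin (dv i))) → ℝ :=
    fun y => ∑ i, (1 - inner ℝ (u i) (y i)) / ballDepth (x i)
  have hg : Continuous g := by
    refine continuous_finsetSum _ fun i _ => Continuous.div_const ?_ _
    exact continuous_const.sub (continuous_const.inner (continuous_apply i))
  refine le_measure_notMem_convexHull (H := {y | g y ≤ m})
    (measurableSet_le hg.measurable measurable_const) ?_ ?_ hn ?_
  · intro y hy z hz a b ha hb hab
    simp only [Set.mem_compl_iff, Set.mem_ofPred_eq, not_le] at hy hz ⊢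
    have h1 : g (a • y + b • z) = a * g y + b * g z := by
      simp only [g, Finset.mul_sum, ← Finset.sum_add_distrib]
      refine Finset.sum_congr rfl fun i _ => ?_
      rw [Pi.add_apply, Pi.smul_apply, Pi.smul_apply, inner_add_right, real_inner_smul_right,
        real_inner_smul_right]
      nth_rewrite 1 [← hab]
      ring
    rw [h1]
    have h2 : a * (m : ℝ) + b * m = m := by rw [← add_mul, hab, one_mul]
    rcases ha.eq_or_lt with rfl | ha
    · have : b = 1 := by linarith
      subst this
      linarith
    · nlinarith
  · simp only [Set.mem_ofPred_eq, g, hux]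
    rw [Finset.sum_congr rfl fun i _ => div_self (hpos i).ne']
    simp
  · rw [uniformDist_prodOfBalls_apply]
    have hsub : {y | g y ≤ m} ∩ prodOfBalls dv ⊆ Set.univ.pi fun i =>
        {y ∈ Metric.closedBall (0 : EuclideanSpace ℝ (Fin (dv i))) 1 |
          1 - inner ℝ (u i) y ≤ m * ballDepth (x i)} := by
      rintro y ⟨hy, hyZ⟩ i -
      refine ⟨hyZ i (Set.mem_univ i), ?_⟩
      rw [← div_le_iff₀ (hpos i)]
      refine le_trans (Finset.single_le_sum
        (f := fun i => (1 - inner ℝ (u i) (y i)) / ballDepth (x i)) (fun j _ => ?_)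
        (Finset.mem_univ i)) hy
      refine div_nonneg ?_ (hpos j).le
      have h1 := real_inner_le_norm (u j) (y j)
      have h2 := mem_closedBall_zero_iff.1 (hyZ j (Set.mem_univ j))
      rw [hu1, one_mul] at h1
      linarith
    calc _ ≤ ENNReal.ofReal (volume (prodOfBalls dv)).toReal⁻¹ *
          ∏ i, ENNReal.ofReal (C i * ballDepth (x i) ^ (((dv i : ℝ) + 1) / 2)) := by
          gcongr
          refine (measure_mono hsub).trans ?_
          rw [volume_pi_pi]
          gcongr with i
          exact hvol i
      _ ≤ _ := by
          rw [prod_ofReal_mul_ballDepth dv dmax hC, ← ENNReal.ofReal_mul (by positivity),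
            ← mul_assoc]
          exact ENNReal.ofReal_le_ofReal hsmall

theorem exp_neg_rpow_le {t p : ℝ} (ht : 0 ≤ t) (hp : 1 ≤ p) :
    Real.exp (-t ^ p) ≤ 4 * (1 / (1 + t) ^ 2) := by
  have h1 : t - 1 ≤ t ^ p := by
    rcases le_total 1 t with h | h
    · linarith [Real.self_le_rpow_of_one_le h hp]
    · linarith [Real.rpow_nonneg ht p]
  have h2 : (1 + t) ^ 2 ≤ 4 * Real.exp (t - 1) := by
    have h3 : (1 + t) / 2 ≤ Real.exp ((t - 1) / 2) := by
      linarith [Real.add_one_le_exp ((t - 1) / 2)]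
    have h4 : Real.exp (t - 1) = Real.exp ((t - 1) / 2) ^ 2 := by
      rw [← Real.exp_nat_mul]
      congr 1
      push_cast
      ring
    have h5 := pow_le_pow_left₀ (by positivity) h3 2
    rw [h4]
    linarith
  calc Real.exp (-t ^ p) ≤ Real.exp (-(t - 1)) := Real.exp_le_exp.2 (neg_le_neg h1)
    _ ≤ 4 * (1 / (1 + t) ^ 2) := by
      rw [Real.exp_neg, mul_one_div, inv_eq_one_div, div_le_div_iff₀ (Real.exp_pos _) (by positivity)]
      linarith

theorem mul_rpow_mul_rpow_inv {a D r : ℝ} (ha : 0 ≤ a) (hD : 0 ≤ D) (hr : 0 < r) :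
    (a ^ (2 / r) * D) ^ (r / 2) = a * D ^ (r / 2) := by
  rw [Real.mul_rpow (Real.rpow_nonneg ha _) hD, ← Real.rpow_mul ha]
  have : 2 / r * (r / 2) = 1 := by field_simp
  rw [this, Real.rpow_one]

theorem ae_ballDepth_pos {m : ℕ} {dv : Fin m → ℕ} :
    ∀ᵐ x ∂volume.restrict (prodOfBalls dv), ∀ i, 0 < ballDepth (x i) := by
  have hball : ∀ i, ∀ᵐ y ∂volume.restrict
      (Metric.closedBall (0 : EuclideanSpace ℝ (Fin (dv i))) 1), 0 < ballDepth y := fun i => by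
    have hsphere : ∀ᵐ y : EuclideanSpace ℝ (Fin (dv i)), y ∉ Metric.sphere 0 (1 : ℝ) :=
      measure_eq_zero_iff_ae_notMem.1 (Measure.addHaar_sphere_of_ne_zero _ _ one_ne_zero)
    filter_upwards [ae_restrict_mem measurableSet_closedBall, ae_restrict_of_ae hsphere]
      with y hy hy'
    rw [ballDepth_of_mem hy]
    rw [mem_closedBall_zero_iff] at hy
    rw [mem_sphere_zero_iff_norm] at hy'
    exact sub_pos.2 (lt_of_le_of_ne hy hy')
  rw [volume_restrict_prodOfBalls]
  exact ae_all_iff.2 fun i => (Measure.tendsto_eval_ae_ae (μ := fun i => volume.restrict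
    (Metric.closedBall (0 : EuclideanSpace ℝ (Fin (dv i))) 1)) (i := i)).eventually (hball i)

theorem lintegral_measure_notMem_convexHull_ne_top {m : ℕ} (dv : Fin m → ℕ) (n : ℕ) :
    (∫⁻ x in prodOfBalls dv, (Measure.pi fun _ : Fin n => uniformDist (prodOfBalls dv))
      {X | x ∉ convexHull ℝ (Set.range X)}) ≠ ⊤ := by
  have := isProbabilityMeasure_uniformDist_prodOfBalls dv
  refine ne_top_of_le_ne_top (volume_prodOfBalls_ne_top dv)
    ((lintegral_mono fun x => prob_le_one).trans (le_of_eq ?_))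
  simp

theorem exists_volume_sub_expectedVolume_le {m : ℕ} {dv : Fin m → ℕ} (hdv : ∀ i, 1 ≤ dv i)
    {dmax : ℕ} (hdmax : IsGreatest (Set.range dv) dmax) :
    ∃ B : ℝ, 0 < B ∧ ∃ C : ℝ, 0 < C ∧ ∀ n : ℕ,
      (volume (prodOfBalls dv)).toReal - expectedVolume dv n ≤
        C * ((1 + Real.log (1 + B * (n : ℝ) ^ (2 / ((dmax : ℝ) + 1)))) ^
          ((Finset.univ.filter fun i => dv i = dmax).card - 1) /
            (1 + B * (n : ℝ) ^ (2 / ((dmax : ℝ) + 1)))) := by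
  have hd1 : (1 : ℝ) ≤ dmax := by
    obtain ⟨i, hi⟩ := hdmax.1
    exact_mod_cast hi ▸ hdv i
  obtain ⟨c, hc, K, hK, hmiss⟩ := exists_measure_notMem_convexHull_le hdv dmax
  obtain ⟨C, hC, hint⟩ := exists_setLIntegral_depthProd_le hdv hdmax
  refine ⟨c ^ (2 / ((dmax : ℝ) + 1)), by positivity, K * 4 * C, by positivity, fun n => ?_⟩
  have hN : c ^ (2 / ((dmax : ℝ) + 1)) * (n : ℝ) ^ (2 / ((dmax : ℝ) + 1)) =
      (c * n) ^ (2 / ((dmax : ℝ) + 1)) := (Real.mul_rpow hc.le (Nat.cast_nonneg n)).symm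
  rw [hN]
  set N := (c * n) ^ (2 / ((dmax : ℝ) + 1)) with hN_def
  have hN0 : 0 ≤ N := by positivity
  have hlog : 0 ≤ Real.log (1 + N) := Real.log_nonneg (by linarith)
  have hle : (∫⁻ x in prodOfBalls dv, (Measure.pi fun _ : Fin n => uniformDist (prodOfBalls dv))
        {X | x ∉ convexHull ℝ (Set.range X)}) ≤ ENNReal.ofReal (K * 4 * C *
        ((1 + Real.log (1 + N)) ^ ((Finset.univ.filter fun i => dv i = dmax).card - 1) /
          (1 + N))) := by
    calc _ ≤ ∫⁻ x in prodOfBalls dv, ENNReal.ofReal (K * 4) *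
          ENNReal.ofReal (1 / (1 + N * depthProd dv dmax x) ^ 2) := by
          refine setLIntegral_mono' (measurableSet_prodOfBalls dv) fun x hx => ?_
          refine (hmiss n x hx).trans ?_
          rw [← ENNReal.ofReal_mul (by positivity), mul_assoc K]
          refine ENNReal.ofReal_le_ofReal (mul_le_mul_of_nonneg_left ?_ hK.le)
          have hD := depthProd_nonneg dv dmax x
          have h1 := exp_neg_rpow_le (mul_nonneg hN0 hD) (p := ((dmax : ℝ) + 1) / 2) (by linarith)
          rw [hN_def, mul_rpow_mul_rpow_inv (by positivity) hD (by positivity)] at h1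
          refine le_trans (le_of_eq ?_) h1
          congr 2
          ring
      _ = ENNReal.ofReal (K * 4) * ∫⁻ x in prodOfBalls dv,
          ENNReal.ofReal (1 / (1 + N * depthProd dv dmax x) ^ 2) :=
          lintegral_const_mul' _ _ ENNReal.ofReal_ne_top
      _ ≤ _ := by
          rw [mul_assoc (K * 4), ENNReal.ofReal_mul (p := K * 4) (by positivity)]
          exact mul_le_mul' le_rfl (hint N hN0)
  rw [toReal_volume_sub_expectedVolume]
  exact ENNReal.toReal_le_of_le_ofReal (by positivity) hle

theorem exists_le_volume_sub_expectedVolume {m : ℕ} {dv : Fin m → ℕ} (hdv : ∀ i, 1 ≤ dv i)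
    {dmax : ℕ} (hdmax : IsGreatest (Set.range dv) dmax) :
    ∃ B : ℝ, 0 < B ∧ ∃ c : ℝ, 0 < c ∧ ∀ n : ℕ, 1 ≤ n →
      c * (Real.log (1 + B * (n : ℝ) ^ (2 / ((dmax : ℝ) + 1))) ^
          ((Finset.univ.filter fun i => dv i = dmax).card - 1) /
            (1 + B * (n : ℝ) ^ (2 / ((dmax : ℝ) + 1)))) ≤
      (volume (prodOfBalls dv)).toReal - expectedVolume dv n := by
  obtain ⟨C, hC, hmiss⟩ := exists_le_measure_notMem_convexHull hdv dmax
  obtain ⟨c, hc, hint⟩ := exists_le_setLIntegral_depthProd hdv hdmax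
  refine ⟨(2 * C) ^ (2 / ((dmax : ℝ) + 1)), by positivity, 1 / 2 * c, by positivity,
    fun n hn => ?_⟩
  have hn' : (0 : ℝ) < n := by exact_mod_cast hn
  rw [← Real.mul_rpow (by positivity) hn'.le]
  set N := (2 * C * n) ^ (2 / ((dmax : ℝ) + 1)) with hN_def
  have hN0 : 0 ≤ N := by positivity
  rw [toReal_volume_sub_expectedVolume, ← ENNReal.ofReal_le_iff_le_toReal 
    (lintegral_measure_notMem_convexHull_ne_top dv n)]
  calc _ ≤ ENNReal.ofReal (1 / 2) * ∫⁻ x in prodOfBalls dv,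
        ENNReal.ofReal (if N * depthProd dv dmax x ≤ 1 then 1 else 0) := by
        rw [mul_assoc, ENNReal.ofReal_mul (by positivity)]
        exact mul_le_mul' le_rfl (hint N hN0)
    _ = ∫⁻ x in prodOfBalls dv, ENNReal.ofReal (1 / 2) *
        ENNReal.ofReal (if N * depthProd dv dmax x ≤ 1 then 1 else 0) :=
        (lintegral_const_mul' _ _ ENNReal.ofReal_ne_top).symm
    _ ≤ _ := by
        refine lintegral_mono_ae ?_
        filter_upwards [ae_ballDepth_pos, ae_restrict_mem (measurableSet_prodOfBalls dv)]
          with x hpos hx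
        split_ifs with h
        · rw [ENNReal.ofReal_one, mul_one]
          refine hmiss n hn x hx hpos ?_
          have hD := depthProd_nonneg dv dmax x
          have h1 := Real.rpow_le_one (mul_nonneg hN0 hD) h
            (z := ((dmax : ℝ) + 1) / 2) (by positivity)
          rw [hN_def, mul_rpow_mul_rpow_inv (by positivity) hD (by positivity)] at h1
          rw [le_div_iff₀ (by positivity)]
          linarith
        · simp

theorem exists_le_liminf_limsup_le {f : ℕ → ℝ} {β B₀ c₀ B₁ C₁ : ℝ} (e : ℕ) (hβ : 0 < β)
    (hB₀ : 0 < B₀) (hc₀ : 0 < c₀) (hB₁ : 0 < B₁) (hC₁ : 0 < C₁)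
    (hlow : ∀ n : ℕ, 1 ≤ n →
      c₀ * (Real.log (1 + B₀ * (n : ℝ) ^ β) ^ e / (1 + B₀ * (n : ℝ) ^ β)) ≤ f n)
    (hup : ∀ n : ℕ,
      f n ≤ C₁ * ((1 + Real.log (1 + B₁ * (n : ℝ) ^ β)) ^ e / (1 + B₁ * (n : ℝ) ^ β))) :
    ∃ c C : ℝ, 0 < c ∧ c ≤ C ∧
      c ≤ liminf (fun n : ℕ => f n / ((n : ℝ) ^ (-β) * Real.log n ^ e)) atTop ∧
      limsup (fun n : ℕ => f n / ((n : ℝ) ^ (-β) * Real.log n ^ e)) atTop ≤ C := by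
  set c := c₀ * ((β / 2) ^ e / (1 + B₀)) with hc_def
  set K := 1 + Real.log (1 + B₁) + β with hK_def
  set C := C₁ * (K ^ e / B₁) with hC_def
  have hlogB : 0 ≤ Real.log (1 + B₁) := Real.log_nonneg (by linarith)
  have hc : 0 < c := by positivity
  have hL : ∀ᶠ n : ℕ in atTop, c ≤ f n / ((n : ℝ) ^ (-β) * Real.log n ^ e) := by
    have h1 : ∀ᶠ n : ℕ in atTop, B₀⁻¹ ≤ (n : ℝ) ^ (β / 2) :=
      ((tendsto_rpow_atTop (half_pos hβ)).comp tendsto_natCast_atTop_atTop).eventually_ge_atTop _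
    filter_upwards [h1, eventually_ge_atTop 3] with n hn hn3
    have hn3' : (3 : ℝ) ≤ n := by exact_mod_cast hn3
    have hn0 : (0 : ℝ) < n := by linarith
    have hlog : 0 < Real.log n := Real.log_pos (by linarith)
    have hpow : 1 ≤ (n : ℝ) ^ β := Real.one_le_rpow (by linarith) hβ.le
    have h2 : (n : ℝ) ^ (β / 2) ≤ 1 + B₀ * (n : ℝ) ^ β := by
      have h3 : (n : ℝ) ^ β = (n : ℝ) ^ (β / 2) * (n : ℝ) ^ (β / 2) := by
        rw [← Real.rpow_add hn0, add_halves]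
      have h4 : 1 ≤ B₀ * (n : ℝ) ^ (β / 2) := by
        rw [inv_eq_one_div, div_le_iff₀ hB₀] at hn
        linarith
      have h5 : 0 ≤ (n : ℝ) ^ (β / 2) := by positivity
      rw [h3]
      nlinarith
    have h3 : β / 2 * Real.log n ≤ Real.log (1 + B₀ * (n : ℝ) ^ β) := by
      rw [← Real.log_rpow hn0]
      exact Real.log_le_log (by positivity) h2
    rw [le_div_iff₀ (by positivity)]
    refine le_trans ?_ (hlow n (by omega))
    calc c * ((n : ℝ) ^ (-β) * Real.log n ^ e)
        = c₀ * ((β / 2 * Real.log n) ^ e / ((1 + B₀) * (n : ℝ) ^ β)) := by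
          rw [hc_def, Real.rpow_neg hn0.le, mul_pow]
          field_simp
      _ ≤ _ := by
          have h4 : 0 ≤ Real.log (1 + B₀ * (n : ℝ) ^ β) :=
            Real.log_nonneg (le_add_of_nonneg_right (by positivity))
          gcongr
          linarith
  have hU : ∀ᶠ n : ℕ in atTop, f n / ((n : ℝ) ^ (-β) * Real.log n ^ e) ≤ C := by
    filter_upwards [eventually_ge_atTop 3] with n hn3
    have hn3' : (3 : ℝ) ≤ n := by exact_mod_cast hn3
    have hn0 : (0 : ℝ) < n := by linarith
    have hlog : 1 ≤ Real.log n := by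
      rw [Real.le_log_iff_exp_le hn0]
      linarith [Real.exp_one_lt_d9]
    have hpow : 1 ≤ (n : ℝ) ^ β := Real.one_le_rpow (by linarith) hβ.le
    have h1 : Real.log (1 + B₁ * (n : ℝ) ^ β) ≤ Real.log (1 + B₁) + β * Real.log n := by
      rw [← Real.log_rpow hn0, ← Real.log_mul (by positivity) (by positivity)]
      exact Real.log_le_log (by positivity) (by linarith)
    have h2 : 1 + Real.log (1 + B₁ * (n : ℝ) ^ β) ≤ K * Real.log n := by
      rw [hK_def]
      nlinarith
    have h3 : 0 ≤ Real.log (1 + B₁ * (n : ℝ) ^ β) :=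
      Real.log_nonneg (le_add_of_nonneg_right (by positivity))
    rw [div_le_iff₀ (by positivity)]
    refine (hup n).trans ?_
    calc _ ≤ C₁ * ((K * Real.log n) ^ e / (B₁ * (n : ℝ) ^ β)) := by
          gcongr
          linarith
      _ = _ := by
          rw [hC_def, Real.rpow_neg hn0.le, mul_pow]
          field_simp
  obtain ⟨n, h1, h2⟩ := (hL.and hU).exists
  exact ⟨c, C, hc, h1.trans h2,
    le_liminf_of_le (isBoundedUnder_of_eventually_le hU).isCoboundedUnder_ge hL,
    limsup_le_of_le (isBoundedUnder_of_eventually_ge hL).isCoboundedUnder_le hU⟩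

/-- **Corollary 1.2 (B), volume difference**: in the uniform case,
`Vol_d(Z_𝕕) − E Vol_d(P_n) ≍ n^{−2/(d_max+1)} (ln n)^{#d_max−1}`. -/
theorem expected_volume_difference_uniform
    (d m : ℕ) (hd : 2 ≤ d) (hm : 1 ≤ m) (hmd : m ≤ d)
    (dv : Fin m → ℕ) (hdv : ∀ i, 1 ≤ dv i) (hsum : ∑ i, dv i = d)
    (dmax : ℕ) (hdmax : IsGreatest (Set.range dv) dmax)
    (ndmax : ℕ) (hndmax : ndmax = (Finset.univ.filter fun i => dv i = dmax).card) :
    ∃ c C : ℝ, 0 < c ∧ c ≤ C ∧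
      c ≤ liminf (fun n : ℕ =>
            ((volume (prodOfBalls dv)).toReal - expectedVolume dv n) /
              ((n : ℝ) ^ (-2 / ((dmax : ℝ) + 1)) * Real.log n ^ (ndmax - 1))) atTop ∧
      limsup (fun n : ℕ =>
            ((volume (prodOfBalls dv)).toReal - expectedVolume dv n) /
              ((n : ℝ) ^ (-2 / ((dmax : ℝ) + 1)) * Real.log n ^ (ndmax - 1))) atTop ≤ C := by
  obtain ⟨B₁, hB₁, C₁, hC₁, hup⟩ := exists_volume_sub_expectedVolume_le hdv hdmax
  obtain ⟨B₀, hB₀, c₀, hc₀, hlow⟩ := exists_le_volume_sub_expectedVolume hdv hdmax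
  rw [hndmax, neg_div]
  exact exists_le_liminf_limsup_le _ (by positivity) hB₀ hc₀ hB₁ hC₁ hlow hup
end
end

section
/- Fix an integer m≥1, real numbers α≥0, c∈(0,1], and a_1≥a_2≥…≥a_m>0 with a_{m−1}>a_m (this last condition being void when m=1). Then ∫_0^1⋯∫_0^1 (1−c x_1⋯x_m)^{n−α} x_1^{a_1}⋯x_m^{a_m} dx_m⋯dx_1 = [Γ(a_m+1)(cn)^{−(a_m+1)} / ∏_{i=1}^{m−1}(a_i−a_m)]·(1+o(1)) as n→∞; equivalently, n^{a_m+1} times the integral converges to Γ(a_m+1) c^{−(a_m+1)} / ∏_{i=1}^{m−1}(a_i−a_m). -/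
open MeasureTheory Filter

noncomputable section

theorem one_sub_div_rpow_tendsto_exp_neg (α t : ℝ) :
    Tendsto (fun n : ℕ => (1 - t / (n : ℝ)) ^ ((n : ℝ) - α)) atTop (nhds (Real.exp (-t))) := by
  have hbase : Tendsto (fun n : ℕ => 1 - t / (n : ℝ)) atTop (nhds 1) := by
    simpa using (tendsto_const_div_atTop_nhds_zero_nat t).const_sub 1
  have hmain : Tendsto (fun n : ℕ => (1 - t / (n : ℝ)) ^ (n : ℝ)) atTop
      (nhds (Real.exp (-t))) := by
    refine ((Real.tendsto_one_add_div_rpow_exp (-t)).comp tendsto_natCast_atTop_atTop).congr ?_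
    intro n
    simp only [Function.comp_apply, neg_div, sub_eq_add_neg]
  have hcorr : Tendsto (fun n : ℕ => (1 - t / (n : ℝ)) ^ (-α)) atTop (nhds 1) := by
    simpa using hbase.rpow_const (p := -α) (Or.inl one_ne_zero)
  have hprod := hmain.mul hcorr
  rw [mul_one] at hprod
  refine hprod.congr' ?_
  filter_upwards [hbase.eventually (lt_mem_nhds one_pos)] with n hn
  rw [← Real.rpow_add hn, ← sub_eq_add_neg]

theorem one_sub_div_rpow_le_exp_neg_half {α t n : ℝ} (hn : 0 < n)
    (hαn : 2 * α ≤ n) (ht : 0 ≤ t) (htn : t ≤ n) :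
    (1 - t / n) ^ (n - α) ≤ Real.exp (-(1 / 2) * t) := by
  have hb : 0 ≤ 1 - t / n := sub_nonneg.2 ((div_le_one hn).2 htn)
  have hle : 1 - t / n ≤ Real.exp (-(t / n)) := Real.one_sub_le_exp_neg _
  calc (1 - t / n) ^ (n - α) ≤ Real.exp (-(t / n)) ^ (n - α) :=
        Real.rpow_le_rpow hb hle (by linarith)
    _ = Real.exp (-(t / n) * (n - α)) := (Real.exp_mul _ _).symm
    _ ≤ Real.exp (-(1 / 2) * t) := by
        apply Real.exp_le_exp.2
        have h : t / n * (n / 2) ≤ t / n * (n - α) :=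
          mul_le_mul_of_nonneg_left (by linarith) (by positivity)
        have h' : t / n * (n / 2) = t / 2 := by field_simp
        linarith

theorem rpow_mul_integral_one_sub_rpow_eq {α b s n : ℝ} (hn : 0 < n) (hs : 0 ≤ s) :
    n ^ (b + 1) * ∫ u in (0 : ℝ)..s, (1 - u) ^ (n - α) * u ^ b =
      ∫ t in Set.Ioi (0 : ℝ), (Set.Ioc 0 (n * s)).indicator
        (fun t => (1 - t / n) ^ (n - α) * t ^ b) t := by
  have hsub := intervalIntegral.integral_comp_div (a := 0) (b := n * s)
    (fun u : ℝ => (1 - u) ^ (n - α) * u ^ b) hn.ne'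
  rw [zero_div, mul_div_cancel_left₀ _ hn.ne', smul_eq_mul] at hsub
  rw [setIntegral_indicator measurableSet_Ioc,
    Set.inter_eq_self_of_subset_right Set.Ioc_subset_Ioi_self,
    ← intervalIntegral.integral_of_le (by positivity), Real.rpow_add_one hn.ne', mul_assoc,
    ← hsub, ← intervalIntegral.integral_const_mul]
  refine intervalIntegral.integral_congr fun t ht => ?_
  rw [Set.uIcc_of_le (by positivity)] at ht
  rw [Real.div_rpow ht.1 hn.le]
  have : n ^ b ≠ 0 := (Real.rpow_pos_of_pos hn b).ne'
  field_simp

theorem rpow_mul_integral_one_sub_rpow_tendsto_Gamma {α b s : ℝ} (hb : 0 < b)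
    (hs0 : 0 < s) (hs1 : s ≤ 1) :
    Tendsto (fun n : ℕ => (n : ℝ) ^ (b + 1) *
        ∫ u in (0 : ℝ)..s, (1 - u) ^ ((n : ℝ) - α) * u ^ b)
      atTop (nhds (Real.Gamma (b + 1))) := by
  rw [Real.Gamma_eq_integral (by linarith : 0 < b + 1)]
  have hlim : Tendsto (fun n : ℕ => ∫ t in Set.Ioi (0 : ℝ), (Set.Ioc 0 ((n : ℝ) * s)).indicator
        (fun t => (1 - t / (n : ℝ)) ^ ((n : ℝ) - α) * t ^ b) t) atTop
      (nhds (∫ t in Set.Ioi (0 : ℝ), Real.exp (-t) * t ^ (b + 1 - 1))) := by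
    refine tendsto_integral_filter_of_dominated_convergence
      (fun t : ℝ => t ^ b * Real.exp (-(1 / 2) * t ^ (1 : ℝ))) ?_ ?_
      (integrableOn_rpow_mul_exp_neg_mul_rpow (by linarith) one_pos (by norm_num)) ?_
    · refine Eventually.of_forall fun n => Measurable.aestronglyMeasurable ?_
      refine Measurable.indicator ?_ measurableSet_Ioc
      fun_prop
    · filter_upwards [eventually_ge_atTop (max 1 ⌈2 * α⌉₊)] with n hn
      have hn0 : (0 : ℝ) < n := by exact_mod_cast (le_max_left _ _).trans hn
      have hαn : 2 * α ≤ n := Nat.ceil_le.1 ((le_max_right _ _).trans hn)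
      filter_upwards [ae_restrict_mem measurableSet_Ioi] with t ht
      have ht0 : (0 : ℝ) < t := ht
      have htb := Real.rpow_nonneg ht0.le b
      by_cases hmem : t ∈ Set.Ioc 0 ((n : ℝ) * s)
      · have htn : t ≤ n := hmem.2.trans (mul_le_of_le_one_right hn0.le hs1)
        have hnn : 0 ≤ 1 - t / (n : ℝ) := sub_nonneg.2 ((div_le_one hn0).2 htn)
        rw [Set.indicator_of_mem hmem, Real.norm_of_nonneg
          (mul_nonneg (Real.rpow_nonneg hnn _) htb), Real.rpow_one, mul_comm (t ^ b)]
        exact mul_le_mul_of_nonneg_right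
          (one_sub_div_rpow_le_exp_neg_half hn0 hαn ht0.le htn) htb
      · rw [Set.indicator_of_notMem hmem, norm_zero]
        exact mul_nonneg htb (Real.exp_nonneg _)
    · filter_upwards [ae_restrict_mem measurableSet_Ioi] with t ht
      have ht0 : (0 : ℝ) < t := ht
      have h := (one_sub_div_rpow_tendsto_exp_neg α t).mul_const (t ^ b)
      rw [add_sub_cancel_right]
      refine h.congr' ?_
      filter_upwards [(tendsto_natCast_atTop_atTop.atTop_mul_const hs0).eventually_ge_atTop t]
        with n hn
      have hmem : t ∈ Set.Ioc 0 ((n : ℝ) * s) := ⟨ht0, hn⟩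
      rw [Set.indicator_of_mem hmem]
  refine hlim.congr' ?_
  filter_upwards [eventually_gt_atTop 0] with n hn
  exact (rpow_mul_integral_one_sub_rpow_eq (by exact_mod_cast hn) hs0.le).symm

theorem integral_one_sub_mul_rpow_eq {p b s : ℝ} (hs : 0 < s) :
    ∫ y in Set.Ioc (0 : ℝ) 1, (1 - s * y) ^ p * y ^ b =
      s ^ (-(b + 1)) * ∫ u in (0 : ℝ)..s, (1 - u) ^ p * u ^ b := by
  have hsub := intervalIntegral.integral_comp_mul_left (a := 0) (b := 1)
    (fun u : ℝ => (1 - u) ^ p * u ^ b) hs.ne'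
  rw [mul_zero, mul_one, smul_eq_mul] at hsub
  rw [← intervalIntegral.integral_of_le zero_le_one, neg_add, ← sub_eq_add_neg,
    Real.rpow_sub_one hs.ne', div_eq_mul_inv, mul_assoc, ← hsub,
    ← intervalIntegral.integral_const_mul]
  refine intervalIntegral.integral_congr fun y hy => ?_
  rw [Set.uIcc_of_le zero_le_one] at hy
  rw [Real.mul_rpow hs.le hy.1, Real.rpow_neg hs.le]
  have : s ^ b ≠ 0 := (Real.rpow_pos_of_pos hs b).ne'
  field_simp

theorem integral_one_sub_rpow_nonneg_and_le {p b s : ℝ} (hp : 0 ≤ p) (hb : 0 ≤ b)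
    (hs0 : 0 ≤ s) (hs1 : s ≤ 1) :
    0 ≤ ∫ u in (0 : ℝ)..s, (1 - u) ^ p * u ^ b ∧
      ∫ u in (0 : ℝ)..s, (1 - u) ^ p * u ^ b ≤ ∫ u in (0 : ℝ)..1, (1 - u) ^ p * u ^ b := by
  have hcont : Continuous fun u : ℝ => (1 - u) ^ p * u ^ b :=
    ((continuous_const.sub continuous_id).rpow_const fun _ => Or.inr hp).mul
      (continuous_id.rpow_const fun _ => Or.inr hb)
  have hnn : ∀ u ∈ Set.Icc (0 : ℝ) 1, 0 ≤ (1 - u) ^ p * u ^ b := fun u hu =>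
    mul_nonneg (Real.rpow_nonneg (by linarith [hu.2]) _) (Real.rpow_nonneg hu.1 _)
  refine ⟨intervalIntegral.integral_nonneg hs0 fun u hu => hnn u ⟨hu.1, hu.2.trans hs1⟩, ?_⟩
  rw [← intervalIntegral.integral_add_adjacent_intervals
    (hcont.intervalIntegrable 0 s) (hcont.intervalIntegrable s 1)]
  exact le_add_of_nonneg_right
    (intervalIntegral.integral_nonneg hs1 fun u hu => hnn u ⟨hs0.trans hu.1, hu.2⟩)

theorem restrict_pi_Icc_eq_pi_restrict_Ioc (ι : Type*) [Fintype ι] :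
    (volume : Measure (ι → ℝ)).restrict (Set.univ.pi fun _ => Set.Icc (0 : ℝ) 1) =
      Measure.pi fun _ => (volume : Measure ℝ).restrict (Set.Ioc 0 1) := by
  rw [volume_pi, Measure.restrict_pi_pi, restrict_Ioc_eq_restrict_Icc]

theorem ae_pi_restrict_Ioc_mem (ι : Type*) [Fintype ι] :
    ∀ᵐ x ∂(Measure.pi fun _ : ι => (volume : Measure ℝ).restrict (Set.Ioc 0 1)),
      ∀ i, x i ∈ Set.Ioc (0 : ℝ) 1 := by
  rw [← Measure.restrict_pi_pi]
  filter_upwards [ae_restrict_mem (MeasurableSet.univ_pi fun _ => measurableSet_Ioc)] with x hx i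
  exact hx i (Set.mem_univ i)

theorem integral_Ioc_rpow_sub_one {r : ℝ} (hr : 0 < r) :
    ∫ y in Set.Ioc (0 : ℝ) 1, y ^ (r - 1) = r⁻¹ := by
  rw [← intervalIntegral.integral_of_le zero_le_one, integral_rpow (Or.inl (by linarith))]
  simp [hr.ne']

theorem integrable_prod_rpow_sub_one {ι : Type*} [Fintype ι] {r : ι → ℝ} (hr : ∀ i, 0 < r i) :
    Integrable (fun x : ι → ℝ => ∏ i, x i ^ (r i - 1))
      (Measure.pi fun _ => (volume : Measure ℝ).restrict (Set.Ioc 0 1)) := by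
  refine Integrable.fintype_prod (f := fun i (y : ℝ) => y ^ (r i - 1)) fun i => ?_
  have h := intervalIntegral.intervalIntegrable_rpow' (a := 0) (b := 1)
    (by linarith [hr i] : -1 < r i - 1)
  exact (intervalIntegrable_iff_integrableOn_Ioc_of_le zero_le_one).1 h

theorem continuous_one_sub_mul_prod_rpow_mul {ι : Type*} [Fintype ι] {p : ℝ} (hp : 0 ≤ p) (c : ℝ)
    {a : ι → ℝ} (ha : ∀ i, 0 ≤ a i) :
    Continuous fun x : ι → ℝ => (1 - c * ∏ i, x i) ^ p * ∏ i, x i ^ a i := by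
  refine Continuous.mul (Continuous.rpow_const (by fun_prop) fun _ => Or.inr hp) ?_
  exact continuous_finsetProd _ fun i _ =>
    (continuous_apply i).rpow_const fun _ => Or.inr (ha i)

theorem integral_pi_Ioc_eq_integral_integral_snoc {k : ℕ} {f : (Fin (k + 1) → ℝ) → ℝ}
    (hf : Continuous f) :
    Integrable (fun x : Fin k → ℝ => ∫ y in Set.Ioc (0 : ℝ) 1, f (Fin.snoc x y))
        (Measure.pi fun _ => (volume : Measure ℝ).restrict (Set.Ioc 0 1)) ∧
      ∫ x in Set.univ.pi fun _ : Fin (k + 1) => Set.Icc (0 : ℝ) 1, f x =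
        ∫ x : Fin k → ℝ, (∫ y in Set.Ioc (0 : ℝ) 1, f (Fin.snoc x y))
          ∂(Measure.pi fun _ => (volume : Measure ℝ).restrict (Set.Ioc 0 1)) := by
  have hint : Integrable f
      (Measure.pi fun _ : Fin (k + 1) => (volume : Measure ℝ).restrict (Set.Ioc 0 1)) := by
    rw [← restrict_pi_Icc_eq_pi_restrict_Ioc]
    exact hf.continuousOn.integrableOn_compact (isCompact_univ_pi fun _ => isCompact_Icc)
  have hmp := (measurePreserving_piFinSuccAbove
    (fun _ : Fin (k + 1) => (volume : Measure ℝ).restrict (Set.Ioc 0 1)) (Fin.last k)).symm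
  have hsnoc : ∀ z : ℝ × (Fin k → ℝ),
      (MeasurableEquiv.piFinSuccAbove (fun _ : Fin (k + 1) => ℝ) (Fin.last k)).symm z =
        Fin.snoc z.2 z.1 := fun z => Fin.insertNth_last' z.1 z.2
  have hint' := (hmp.integrable_comp_emb (MeasurableEquiv.measurableEmbedding _)).2 hint
  simp only [Function.comp_def, hsnoc] at hint'
  refine ⟨hint'.integral_prod_right, ?_⟩
  rw [restrict_pi_Icc_eq_pi_restrict_Ioc, ← hmp.integral_comp']
  simp only [hsnoc]
  exact integral_prod_symm _ hint'

theorem integral_snoc_eq {k : ℕ} {p c : ℝ} (hc : 0 < c) (a : Fin (k + 1) → ℝ) {x : Fin k → ℝ}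
    (hx : ∀ i, x i ∈ Set.Ioc (0 : ℝ) 1) :
    ∫ y in Set.Ioc (0 : ℝ) 1, (1 - c * ∏ i, Fin.snoc (α := fun _ => ℝ) x y i) ^ p *
        ∏ i, Fin.snoc (α := fun _ => ℝ) x y i ^ a i =
      c ^ (-(a (Fin.last k) + 1)) *
        (∏ i, x i ^ (a i.castSucc - a (Fin.last k) - 1)) *
        ∫ u in (0 : ℝ)..(c * ∏ i, x i), (1 - u) ^ p * u ^ a (Fin.last k) := by
  have hP : 0 < ∏ i, x i := Finset.prod_pos fun i _ => (hx i).1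
  have hprod : ∏ i, x i ^ (a i.castSucc - a (Fin.last k) - 1) =
      (∏ i, x i ^ a i.castSucc) * (∏ i, x i) ^ (-(a (Fin.last k) + 1)) := by
    rw [← Real.finsetProd_rpow _ _ fun i _ => (hx i).1.le, ← Finset.prod_mul_distrib]
    refine Finset.prod_congr rfl fun i _ => ?_
    rw [← Real.rpow_add (hx i).1]
    congr 1
    ring
  have hinner := integral_one_sub_mul_rpow_eq (p := p) (b := a (Fin.last k)) (mul_pos hc hP)
  rw [Real.mul_rpow hc.le hP.le] at hinner
  rw [hprod, mul_left_comm, mul_assoc, ← hinner, ← integral_const_mul]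
  simp only [Fin.prod_univ_castSucc, Fin.snoc_castSucc, Fin.snoc_last]
  refine integral_congr_ae (Eventually.of_forall fun y => ?_)
  simp only
  ring_nf

theorem integral_asymptotics_succ {k : ℕ} {α c : ℝ} (hc0 : 0 < c) (hc1 : c ≤ 1)
    {a : Fin (k + 1) → ℝ} (hpos : ∀ i, 0 < a i)
    (hlast : ∀ i : Fin k, a (Fin.last k) < a i.castSucc) :
    Tendsto (fun n : ℕ => (n : ℝ) ^ (a (Fin.last k) + 1) *
        ∫ x in Set.univ.pi fun _ : Fin (k + 1) => Set.Icc (0 : ℝ) 1,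
          (1 - c * ∏ i, x i) ^ ((n : ℝ) - α) * ∏ i, x i ^ a i)
      atTop
      (nhds (Real.Gamma (a (Fin.last k) + 1) * c ^ (-(a (Fin.last k) + 1)) /
        ∏ i : Fin k, (a i.castSucc - a (Fin.last k)))) := by
  set b := a (Fin.last k)
  have hb : 0 < b := hpos _
  set w : (Fin k → ℝ) → ℝ := fun x => c ^ (-(b + 1)) * ∏ i, x i ^ (a i.castSucc - b - 1)
    with hw
  have hwint : Integrable w
      (Measure.pi fun _ => (volume : Measure ℝ).restrict (Set.Ioc 0 1)) :=
    (integrable_prod_rpow_sub_one fun i => sub_pos.2 (hlast i)).const_mul _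
  have hwval : ∫ x, w x * Real.Gamma (b + 1)
      ∂(Measure.pi fun _ => (volume : Measure ℝ).restrict (Set.Ioc 0 1)) =
      Real.Gamma (b + 1) * c ^ (-(b + 1)) / ∏ i : Fin k, (a i.castSucc - b) := by
    rw [integral_mul_const, hw, integral_const_mul, integral_fintype_prod_eq_prod
      (f := fun (i : Fin k) (y : ℝ) => y ^ (a i.castSucc - b - 1)),
      Finset.prod_congr rfl fun i _ => integral_Ioc_rpow_sub_one (sub_pos.2 (hlast i)),
      Finset.prod_inv_distrib]
    ring
  have hcont : ∀ n : ℕ, α ≤ n → Continuous fun x : Fin (k + 1) → ℝ =>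
      (1 - c * ∏ i, x i) ^ ((n : ℝ) - α) * ∏ i, x i ^ a i := fun n hn =>
    continuous_one_sub_mul_prod_rpow_mul (sub_nonneg.2 hn) c fun i => (hpos i).le
  have hlarge : ∀ᶠ n : ℕ in atTop, α ≤ n := tendsto_natCast_atTop_atTop.eventually_ge_atTop α
  have harg : ∀ x : Fin k → ℝ, (∀ i, x i ∈ Set.Ioc (0 : ℝ) 1) →
      0 < c * ∏ i, x i ∧ c * ∏ i, x i ≤ 1 := fun x hx =>
    ⟨mul_pos hc0 (Finset.prod_pos fun i _ => (hx i).1),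
      mul_le_one₀ hc1 (Finset.prod_nonneg fun i _ => (hx i).1.le)
        (Finset.prod_le_one (fun i _ => (hx i).1.le) fun i _ => (hx i).2)⟩
  have hdct : Tendsto (fun n : ℕ => ∫ x : Fin k → ℝ, (n : ℝ) ^ (b + 1) *
        (∫ y in Set.Ioc (0 : ℝ) 1, (1 - c * ∏ i, Fin.snoc (α := fun _ => ℝ) x y i) ^ ((n : ℝ) - α) *
          ∏ i, Fin.snoc (α := fun _ => ℝ) x y i ^ a i)
        ∂(Measure.pi fun _ => (volume : Measure ℝ).restrict (Set.Ioc 0 1))) atTop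
      (nhds (∫ x, w x * Real.Gamma (b + 1)
        ∂(Measure.pi fun _ => (volume : Measure ℝ).restrict (Set.Ioc 0 1)))) := by
    refine tendsto_integral_filter_of_dominated_convergence
      (fun x => w x * (Real.Gamma (b + 1) + 1)) ?_ ?_ (hwint.mul_const _) ?_
    · filter_upwards [hlarge] with n hn
      exact ((integral_pi_Ioc_eq_integral_integral_snoc (hcont n hn)).1.const_mul
        _).aestronglyMeasurable
    · have hone := rpow_mul_integral_one_sub_rpow_tendsto_Gamma (α := α) hb one_pos le_rfl
      filter_upwards [hlarge, hone.eventually (gt_mem_nhds (lt_add_one _))] with n hn hlt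
      filter_upwards [ae_pi_restrict_Ioc_mem (Fin k)] with x hx
      have hmono := integral_one_sub_rpow_nonneg_and_le (sub_nonneg.2 hn) hb.le
        (harg x hx).1.le (harg x hx).2
      have hnb : (0 : ℝ) ≤ (n : ℝ) ^ (b + 1) := by positivity
      have hwnn : 0 ≤ w x := mul_nonneg (Real.rpow_nonneg hc0.le _)
        (Finset.prod_nonneg fun i _ => Real.rpow_nonneg (hx i).1.le _)
      rw [integral_snoc_eq hc0 a hx, mul_left_comm,
        Real.norm_of_nonneg (mul_nonneg hwnn (mul_nonneg hnb hmono.1))]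
      exact mul_le_mul_of_nonneg_left
        ((mul_le_mul_of_nonneg_left hmono.2 hnb).trans hlt.le) hwnn
    · filter_upwards [ae_pi_restrict_Ioc_mem (Fin k)] with x hx
      refine ((rpow_mul_integral_one_sub_rpow_tendsto_Gamma (α := α) hb
        (harg x hx).1 (harg x hx).2).const_mul (w x)).congr fun n => ?_
      rw [integral_snoc_eq hc0 a hx, mul_left_comm]
  rw [← hwval]
  refine hdct.congr' ?_
  filter_upwards [hlarge] with n hn
  rw [integral_const_mul, (integral_pi_Ioc_eq_integral_integral_snoc (hcont n hn)).2]

/-- **Lemma 2.3 (1)** (Affentranger–Wieacker type integral asymptotics): if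
`a_1 ≥ ⋯ ≥ a_m > 0` with `a_{m−1} > a_m`, `α ≥ 0` and `c ∈ (0,1]`, then
`∫_{[0,1]^m} (1 − c x_1 ⋯ x_m)^{n−α} x_1^{a_1} ⋯ x_m^{a_m} dx
  = Γ(a_m+1)(cn)^{−(a_m+1)} / ∏_{i<m}(a_i − a_m) · (1+o(1))`,
stated as convergence of `n^{a_m+1}` times the integral. -/
theorem integral_asymptotics_distinct
    (m : ℕ) (hm : 1 ≤ m) (α : ℝ) (hα : 0 ≤ α) (c : ℝ) (hc0 : 0 < c) (hc1 : c ≤ 1)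
    (a : Fin m → ℝ) (hpos : ∀ i, 0 < a i)
    (hmono : ∀ i j : Fin m, i ≤ j → a j ≤ a i)
    (hgap : ∀ h2 : 2 ≤ m, a ⟨m - 1, by omega⟩ < a ⟨m - 2, by omega⟩) :
    Tendsto (fun n : ℕ =>
        (n : ℝ) ^ (a ⟨m - 1, by omega⟩ + 1) *
          ∫ x in Set.univ.pi fun _ : Fin m => Set.Icc (0 : ℝ) 1,
            (1 - c * ∏ i, x i) ^ ((n : ℝ) - α) * ∏ i, x i ^ a i)
      atTop
      (nhds (Real.Gamma (a ⟨m - 1, by omega⟩ + 1) * c ^ (-(a ⟨m - 1, by omega⟩ + 1)) /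
        ∏ i ∈ Finset.univ.filter fun i : Fin m => (i : ℕ) < m - 1,
          (a i - a ⟨m - 1, by omega⟩))) := by
  obtain ⟨k, rfl⟩ : ∃ k, m = k + 1 := ⟨m - 1, by omega⟩
  have hlast : ∀ i : Fin k, a (Fin.last k) < a i.castSucc := fun i => by
    have hi := i.isLt
    exact (hgap (by omega)).trans_le (hmono _ _ (by
      rw [Fin.le_def]
      simp only [Fin.val_castSucc]
      omega))
  have hprod : ∏ i ∈ Finset.univ.filter fun i : Fin (k + 1) => (i : ℕ) < k + 1 - 1,
      (a i - a (Fin.last k)) = ∏ i : Fin k, (a i.castSucc - a (Fin.last k)) := by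
    rw [Finset.prod_filter, Fin.prod_univ_castSucc]
    simp
  have h := integral_asymptotics_succ (α := α) hc0 hc1 hpos hlast
  rw [← hprod] at h
  exact h
end
end

section
/- Let m≥1 and β=(β_1,…,β_m)∈(−1,∞)^m. There exist constants 0<c≤C depending only on m and β such that for every v∈S_+^{m−1} and every s with −‖v‖_1<s<‖v‖_1 one has c·∏_{i=1}^m (min{(‖v‖_1−s)/(2v_i),1})^{β_i+1} ≤ P_m(C^+(v,s);β) ≤ C·∏_{i=1}^m (min{(‖v‖_1−s)/(2v_i),1})^{β_i+1}, where for v_i=0 the minimum is interpreted as 1. -/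
open MeasureTheory Filter
open scoped RealInnerProductSpace

noncomputable section

/-- Normalizing constant `c_β = c_{β,1}` of the one-dimensional beta density on `[−1,1]`. -/
def betaConst1 (β : ℝ) : ℝ :=
  Real.Gamma (3 / 2 + β) / (Real.pi ^ ((1 : ℝ) / 2) * Real.Gamma (β + 1))

/-- The `β`-content `P_m(A;β) = ∫_A ∏_i c_{β_i}(1−y_i²)^{β_i} dy` of a set
`A ⊆ [−1,1]^m`. -/
def betaContent {m : ℕ} (β : Fin m → ℝ) (A : Set (EuclideanSpace ℝ (Fin m))) : ℝ :=
  ∫ y in A, ∏ i, betaConst1 (β i) * (1 - y i ^ 2) ^ (β i)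

/-- The meta-cap `C^+(v,s) = [−1,1]^m ∩ H^+(v,s)`. -/
def metaCap {m : ℕ} (v : EuclideanSpace ℝ (Fin m)) (s : ℝ) :
    Set (EuclideanSpace ℝ (Fin m)) :=
  {y | (∀ i, |y i| ≤ 1) ∧ s ≤ ⟪y, v⟫}

theorem betaConst1_pos {β : ℝ} (hβ : -1 < β) : 0 < betaConst1 β := by
  unfold betaConst1
  have h1 : 0 < Real.Gamma (3 / 2 + β) := Real.Gamma_pos_of_pos (by linarith)
  have h2 : 0 < Real.Gamma (β + 1) := Real.Gamma_pos_of_pos (by linarith)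
  have := Real.pi_pos
  positivity

theorem one_sub_sq_rpow_bounds (β : ℝ) {y : ℝ} (hy : y ∈ Set.Icc (0 : ℝ) 1) :
    min 1 (2 ^ β) * (1 - y) ^ β ≤ (1 - y ^ 2) ^ β ∧
      (1 - y ^ 2) ^ β ≤ max 1 (2 ^ β) * (1 - y) ^ β := by
  obtain ⟨h0, h1⟩ := hy
  have hfac : (1 - y ^ 2) ^ β = (1 + y) ^ β * (1 - y) ^ β := by
    rw [← Real.mul_rpow (by linarith) (by linarith)]
    ring_nf
  have hnonneg : 0 ≤ (1 - y) ^ β := Real.rpow_nonneg (by linarith) _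
  rw [hfac]
  suffices min 1 (2 ^ β) ≤ (1 + y) ^ β ∧ (1 + y) ^ β ≤ max 1 (2 ^ β) from
    ⟨mul_le_mul_of_nonneg_right this.1 hnonneg, mul_le_mul_of_nonneg_right this.2 hnonneg⟩
  rcases le_total 0 β with hβ | hβ
  · exact ⟨min_le_of_left_le (Real.one_le_rpow (by linarith) hβ),
      le_max_of_le_right (Real.rpow_le_rpow (by linarith) (by linarith) hβ)⟩
  · exact ⟨min_le_of_right_le (Real.rpow_le_rpow_of_nonpos (by linarith) (by linarith) hβ),
      le_max_of_le_left (Real.rpow_le_one_of_one_le_of_nonpos (by linarith) hβ)⟩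

theorem integrableOn_one_sub_rpow {β : ℝ} (hβ : -1 < β) {h : ℝ} (hh : 0 ≤ h) :
    IntegrableOn (fun y : ℝ => (1 - y) ^ β) (Set.Icc (1 - h) 1) := by
  have hint : IntervalIntegrable (fun y : ℝ => (1 - y) ^ β) volume (1 - h) (1 - 0) :=
    ((intervalIntegral.intervalIntegrable_rpow' (a := 0) (b := h) hβ).comp_sub_left 1).symm
  rw [sub_zero] at hint
  exact (intervalIntegrable_iff_integrableOn_Icc_of_le (by linarith)).1 hint

theorem setIntegral_one_sub_rpow {β : ℝ} (hβ : -1 < β) {h : ℝ} (hh : 0 ≤ h) :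
    ∫ y in Set.Icc (1 - h) 1, (1 - y) ^ β = h ^ (β + 1) / (β + 1) := by
  rw [integral_Icc_eq_integral_Ioc, ← intervalIntegral.integral_of_le (by linarith),
    intervalIntegral.integral_comp_sub_left (fun x => x ^ β) 1, integral_rpow (Or.inl hβ)]
  simp [Real.zero_rpow (by linarith : β + 1 ≠ 0)]

theorem integrableOn_one_sub_sq_rpow {β : ℝ} (hβ : -1 < β) :
    IntegrableOn (fun y : ℝ => (1 - y ^ 2) ^ β) (Set.Icc (-1) 1) := by
  have hpos : IntegrableOn (fun y : ℝ => (1 - y ^ 2) ^ β) (Set.Icc 0 1) := by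
    have hdom := (integrableOn_one_sub_rpow hβ zero_le_one).const_mul (max 1 (2 ^ β))
    rw [sub_self] at hdom
    refine hdom.mono' (Measurable.aestronglyMeasurable (by fun_prop)) ?_
    filter_upwards [ae_restrict_mem measurableSet_Icc] with y hy
    have hy2 : 0 ≤ 1 - y ^ 2 := by nlinarith [hy.1, hy.2]
    rw [Real.norm_of_nonneg (Real.rpow_nonneg hy2 _)]
    exact (one_sub_sq_rpow_bounds β hy).2
  have hI := (intervalIntegrable_iff_integrableOn_Icc_of_le zero_le_one).2 hpos
  have hneg := (IntervalIntegrable.iff_comp_neg (by finiteness)).1 hI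
  simp only [neg_sq, neg_zero] at hneg
  exact (intervalIntegrable_iff_integrableOn_Icc_of_le (by norm_num)).1 (hneg.symm.trans hI)

theorem integrableOn_betaDensity {β : ℝ} (hβ : -1 < β) {a : ℝ} (ha : a ≤ 1) :
    IntegrableOn (fun y : ℝ => betaConst1 β * (1 - y ^ 2) ^ β) (Set.Icc (1 - 2 * a) 1) :=
  ((integrableOn_one_sub_sq_rpow hβ).mono_set
    (Set.Icc_subset_Icc_left (by linarith))).const_mul _

theorem betaDensity_nonneg {β : ℝ} (hβ : -1 < β) {y : ℝ} (hy : |y| ≤ 1) :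
    0 ≤ betaConst1 β * (1 - y ^ 2) ^ β :=
  mul_nonneg (betaConst1_pos hβ).le
    (Real.rpow_nonneg (sub_nonneg.2 ((sq_le_one_iff_abs_le_one y).2 hy)) _)

/-- The mass that the unnormalized beta density gives to `[1 - 2a, 1]` is comparable to
`a ^ (β + 1)` when `a ≤ 1 / 2`. -/
theorem setIntegral_one_sub_sq_rpow_bounds {β : ℝ} (hβ : -1 < β) {a : ℝ} (ha : 0 ≤ a)
    (ha' : a ≤ 1 / 2) :
    min 1 (2 ^ β) * ((2 * a) ^ (β + 1) / (β + 1)) ≤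
        ∫ y in Set.Icc (1 - 2 * a) 1, (1 - y ^ 2) ^ β ∧
      ∫ y in Set.Icc (1 - 2 * a) 1, (1 - y ^ 2) ^ β ≤
        max 1 (2 ^ β) * ((2 * a) ^ (β + 1) / (β + 1)) := by
  have hsub : Set.Icc (1 - 2 * a) 1 ⊆ Set.Icc (0 : ℝ) 1 :=
    Set.Icc_subset_Icc_left (by linarith)
  have hint : IntegrableOn (fun y : ℝ => (1 - y ^ 2) ^ β) (Set.Icc (1 - 2 * a) 1) :=
    (integrableOn_one_sub_sq_rpow hβ).mono_set (Set.Icc_subset_Icc_left (by linarith))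
  have hint' := integrableOn_one_sub_rpow hβ (by linarith : 0 ≤ 2 * a)
  rw [← setIntegral_one_sub_rpow hβ (by linarith), ← integral_const_mul, ← integral_const_mul]
  exact ⟨setIntegral_mono_on (hint'.const_mul _) hint measurableSet_Icc
      fun y hy => (one_sub_sq_rpow_bounds β (hsub hy)).1,
    setIntegral_mono_on hint (hint'.const_mul _) measurableSet_Icc
      fun y hy => (one_sub_sq_rpow_bounds β (hsub hy)).2⟩

theorem exists_lower_bound_setIntegral_betaDensity {β : ℝ} (hβ : -1 < β) :
    ∃ k : ℝ, 0 < k ∧ ∀ a : ℝ, 0 ≤ a → a ≤ 1 / 2 →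
      k * a ^ (β + 1) ≤ ∫ y in Set.Icc (1 - 2 * a) 1, betaConst1 β * (1 - y ^ 2) ^ β := by
  have hc := betaConst1_pos hβ
  have hβ1 : 0 < β + 1 := by linarith
  have hmin : 0 < min 1 ((2 : ℝ) ^ β) := lt_min one_pos (by positivity)
  refine ⟨betaConst1 β * (min 1 (2 ^ β) * (2 ^ (β + 1) / (β + 1))), by positivity, ?_⟩
  intro a ha ha'
  have := mul_le_mul_of_nonneg_left (setIntegral_one_sub_sq_rpow_bounds hβ ha ha').1 hc.le
  rw [integral_const_mul]
  refine le_trans (le_of_eq ?_) this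
  rw [Real.mul_rpow zero_le_two ha]
  ring

theorem exists_upper_bound_setIntegral_betaDensity {β : ℝ} (hβ : -1 < β) :
    ∃ K : ℝ, 0 < K ∧ ∀ a : ℝ, 0 ≤ a → a ≤ 1 →
      ∫ y in Set.Icc (1 - 2 * a) 1, betaConst1 β * (1 - y ^ 2) ^ β ≤ K * a ^ (β + 1) := by
  have hc := betaConst1_pos hβ
  have hβ1 : 0 < β + 1 := by linarith
  have hmax : 0 < max 1 ((2 : ℝ) ^ β) := lt_max_of_lt_left one_pos
  set K₁ := betaConst1 β * (max 1 (2 ^ β) * (2 ^ (β + 1) / (β + 1))) with hK₁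
  set I := ∫ y in Set.Icc (1 - 2 * (1 : ℝ)) 1, betaConst1 β * (1 - y ^ 2) ^ β with hI
  have hnn : 0 ≤ᵐ[volume.restrict (Set.Icc (1 - 2 * (1 : ℝ)) 1)]
      fun y : ℝ => betaConst1 β * (1 - y ^ 2) ^ β := by
    filter_upwards [ae_restrict_mem measurableSet_Icc] with y hy
    exact betaDensity_nonneg hβ (abs_le.2 ⟨by linarith [hy.1], hy.2⟩)
  have hI0 : 0 ≤ I := integral_nonneg_of_ae hnn
  have hK₁pos : 0 < K₁ := by positivity
  refine ⟨K₁ + I * 2 ^ (β + 1), by positivity, ?_⟩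
  intro a ha ha'
  rcases le_total a (1 / 2) with h | h
  · have := mul_le_mul_of_nonneg_left (setIntegral_one_sub_sq_rpow_bounds hβ ha h).2 hc.le
    rw [integral_const_mul]
    refine this.trans ?_
    calc _ = K₁ * a ^ (β + 1) := by
          rw [Real.mul_rpow zero_le_two ha, hK₁]
          ring
      _ ≤ _ := mul_le_mul_of_nonneg_right (le_add_of_nonneg_right (by positivity))
          (by positivity)
  · have hone : 1 ≤ (2 : ℝ) ^ (β + 1) * a ^ (β + 1) := by
      rw [← Real.mul_rpow zero_le_two ha]
      exact Real.one_le_rpow (by linarith) hβ1.le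
    calc _ ≤ I := setIntegral_mono_set (integrableOn_betaDensity hβ le_rfl) hnn
          (Set.Icc_subset_Icc_left (by linarith)).eventuallyLE
      _ ≤ I * (2 ^ (β + 1) * a ^ (β + 1)) := le_mul_of_one_le_right hI0 hone
      _ ≤ _ := by
        have : 0 ≤ K₁ * a ^ (β + 1) := by positivity
        linarith

/-- The box `∏ i, [1 - 2 a i, 1]` at the corner `(1, …, 1)` of the cube. -/
def cornerBox {m : ℕ} (a : Fin m → ℝ) : Set (EuclideanSpace ℝ (Fin m)) :=
  {y | ∀ i, y i ∈ Set.Icc (1 - 2 * a i) 1}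

theorem cornerBox_eq_preimage {m : ℕ} (a : Fin m → ℝ) :
    cornerBox a = WithLp.ofLp ⁻¹' Set.univ.pi fun i => Set.Icc (1 - 2 * a i) 1 := by
  ext y
  simp only [cornerBox, Set.mem_ofPred_eq, Set.mem_preimage, Set.mem_univ_pi]

theorem measurableSet_cornerBox {m : ℕ} (a : Fin m → ℝ) : MeasurableSet (cornerBox a) := by
  rw [cornerBox_eq_preimage]
  exact (PiLp.volume_preserving_ofLp (Fin m)).measurable
    (MeasurableSet.univ_pi fun _ => measurableSet_Icc)

theorem betaContent_cornerBox {m : ℕ} (β a : Fin m → ℝ) :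
    betaContent β (cornerBox a) =
      ∏ i, ∫ y in Set.Icc (1 - 2 * a i) 1, betaConst1 (β i) * (1 - y ^ 2) ^ (β i) := by
  rw [betaContent, cornerBox_eq_preimage,
    (PiLp.volume_preserving_ofLp (Fin m)).setIntegral_preimage_emb
      (MeasurableEquiv.toLp 2 (Fin m → ℝ)).symm.measurableEmbedding
      (fun y => ∏ i, betaConst1 (β i) * (1 - y i ^ 2) ^ (β i)),
    volume_pi, Measure.restrict_pi_pi]
  exact integral_fintype_prod_eq_prod
    (fun i y => betaConst1 (β i) * (1 - y ^ 2) ^ (β i))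

theorem integrableOn_cornerBox {m : ℕ} {β a : Fin m → ℝ} (hβ : ∀ i, -1 < β i)
    (ha : ∀ i, a i ≤ 1) :
    IntegrableOn (fun y : EuclideanSpace ℝ (Fin m) =>
      ∏ i, betaConst1 (β i) * (1 - y i ^ 2) ^ (β i)) (cornerBox a) := by
  rw [cornerBox_eq_preimage]
  refine ((PiLp.volume_preserving_ofLp (Fin m)).integrableOn_comp_preimage
    (MeasurableEquiv.toLp 2 (Fin m → ℝ)).symm.measurableEmbedding
    (f := fun y => ∏ i, betaConst1 (β i) * (1 - y i ^ 2) ^ (β i))).2 ?_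
  rw [IntegrableOn, volume_pi, Measure.restrict_pi_pi]
  exact Integrable.fintype_prod (f := fun i y => betaConst1 (β i) * (1 - y ^ 2) ^ (β i))
    fun i => integrableOn_betaDensity (hβ i) (ha i)

theorem betaContent_mono {m : ℕ} {β : Fin m → ℝ} (hβ : ∀ i, -1 < β i)
    {A B : Set (EuclideanSpace ℝ (Fin m))} (hAB : A ⊆ B) (hB : ∀ y ∈ B, ∀ i, |y i| ≤ 1)
    (hBm : MeasurableSet B) :
    betaContent β A ≤ betaContent β B := by
  have hsub : B ⊆ cornerBox fun _ => 1 := fun y hy i => by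
    have := abs_le.1 (hB y hy i)
    exact ⟨by linarith [this.1], this.2⟩
  refine setIntegral_mono_set ((integrableOn_cornerBox hβ fun _ => le_rfl).mono_set hsub) ?_
    hAB.eventuallyLE
  filter_upwards [ae_restrict_mem hBm] with y hy
  exact Finset.prod_nonneg fun i _ => betaDensity_nonneg (hβ i) (hB y hy i)

theorem abs_le_one_of_mem_cornerBox {m : ℕ} {a : Fin m → ℝ} (ha : ∀ i, a i ≤ 1)
    {y : EuclideanSpace ℝ (Fin m)} (hy : y ∈ cornerBox a) (i : Fin m) : |y i| ≤ 1 :=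
  abs_le.2 ⟨by linarith [(hy i).1, ha i], (hy i).2⟩

theorem real_inner_eq_sum_mul {m : ℕ} (y v : EuclideanSpace ℝ (Fin m)) :
    ⟪y, v⟫ = ∑ i, v i * y i := by
  simp [PiLp.inner_apply]

theorem measurableSet_metaCap {m : ℕ} (v : EuclideanSpace ℝ (Fin m)) (s : ℝ) :
    MeasurableSet (metaCap v s) := by
  have h1 : IsClosed {y : EuclideanSpace ℝ (Fin m) | ∀ i, |y i| ≤ 1} := by
    simp only [Set.ofPred_forall]
    exact isClosed_iInter fun i => isClosed_le (by fun_prop) continuous_const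
  have h2 : IsClosed {y : EuclideanSpace ℝ (Fin m) | s ≤ ⟪y, v⟫} :=
    isClosed_le continuous_const (by fun_prop)
  exact (h1.inter h2).measurableSet

/-- The `i`-th factor `min {(‖v‖₁ - s) / (2 v_i), 1}`, read as `1` when `v_i = 0`. -/
def capRatio {m : ℕ} (v : EuclideanSpace ℝ (Fin m)) (s : ℝ) (i : Fin m) : ℝ :=
  if v i = 0 then 1 else min (((∑ j, v j) - s) / (2 * v i)) 1

theorem capRatio_le_one {m : ℕ} (v : EuclideanSpace ℝ (Fin m)) (s : ℝ) (i : Fin m) :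
    capRatio v s i ≤ 1 := by
  unfold capRatio
  split_ifs
  · exact le_rfl
  · exact min_le_right _ _

theorem capRatio_nonneg {m : ℕ} {v : EuclideanSpace ℝ (Fin m)} {s : ℝ} (hv : ∀ i, 0 ≤ v i)
    (hs : s < ∑ i, v i) (i : Fin m) : 0 ≤ capRatio v s i := by
  unfold capRatio
  split_ifs
  · exact zero_le_one
  · exact le_min (div_nonneg (by linarith) (by linarith [hv i])) zero_le_one

theorem mul_capRatio_le {m : ℕ} {v : EuclideanSpace ℝ (Fin m)} {s : ℝ} (hv : ∀ i, 0 ≤ v i)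
    (hs : s < ∑ i, v i) (i : Fin m) : 2 * v i * capRatio v s i ≤ (∑ j, v j) - s := by
  unfold capRatio
  split_ifs with h
  · rw [h]
    linarith
  · have hpos : 0 < 2 * v i := by linarith [lt_of_le_of_ne (hv i) (Ne.symm h)]
    calc _ ≤ 2 * v i * (((∑ j, v j) - s) / (2 * v i)) :=
          mul_le_mul_of_nonneg_left (min_le_left _ _) hpos.le
      _ = _ := mul_div_cancel₀ _ hpos.ne'

theorem metaCap_subset_cornerBox {m : ℕ} {v : EuclideanSpace ℝ (Fin m)} {s : ℝ}
    (hv : ∀ i, 0 ≤ v i) : metaCap v s ⊆ cornerBox (capRatio v s) := by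
  rintro y ⟨hy, hys⟩ i
  have hyi := abs_le.1 (hy i)
  refine ⟨?_, hyi.2⟩
  unfold capRatio
  split_ifs with h
  · linarith [hyi.1]
  have hpos : 0 < v i := lt_of_le_of_ne (hv i) (Ne.symm h)
  have hdef : v i * (1 - y i) ≤ (∑ j, v j) - s := by
    rw [real_inner_eq_sum_mul] at hys
    calc v i * (1 - y i) ≤ ∑ j, v j * (1 - y j) :=
          Finset.single_le_sum (f := fun j => v j * (1 - y j))
            (fun j _ => mul_nonneg (hv j) (by linarith [(abs_le.1 (hy j)).2]))
            (Finset.mem_univ i)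
      _ = (∑ j, v j) - ∑ j, v j * y j := by
          rw [← Finset.sum_sub_distrib]
          exact Finset.sum_congr rfl fun j _ => by ring
      _ ≤ _ := by linarith
  have hmin : (1 - y i) / 2 ≤ min (((∑ j, v j) - s) / (2 * v i)) 1 := by
    refine le_min ?_ (by linarith [hyi.1])
    rw [div_le_div_iff₀ two_pos (by linarith)]
    linarith
  linarith

theorem cornerBox_subset_metaCap {m : ℕ} (hm : 1 ≤ m) {v : EuclideanSpace ℝ (Fin m)} {s : ℝ}
    (hv : ∀ i, 0 ≤ v i) (hs : s < ∑ i, v i) :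
    cornerBox (fun i => capRatio v s i / (2 * m)) ⊆ metaCap v s := by
  have hm1 : (1 : ℝ) ≤ m := by exact_mod_cast hm
  intro y hy
  refine ⟨abs_le_one_of_mem_cornerBox (fun i => ?_) hy, ?_⟩
  · rw [div_le_one (by linarith)]
    linarith [capRatio_le_one v s i]
  have hterm : ∀ i, v i * (1 - y i) ≤ ((∑ j, v j) - s) / m := fun i => by
    have h1 : 1 - y i ≤ 2 * (capRatio v s i / (2 * m)) := by linarith [(hy i).1]
    calc v i * (1 - y i) ≤ v i * (2 * (capRatio v s i / (2 * m))) :=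
          mul_le_mul_of_nonneg_left h1 (hv i)
      _ = 2 * v i * capRatio v s i / 2 / m := by ring
      _ ≤ ((∑ j, v j) - s) / m := by
          gcongr
          linarith [mul_capRatio_le hv hs i]
  have hsum : ∑ i, v i * (1 - y i) ≤ (∑ j, v j) - s := by
    refine (Finset.sum_le_sum fun i _ => hterm i).trans (le_of_eq ?_)
    rw [Finset.sum_const, Finset.card_univ, Fintype.card_fin, nsmul_eq_mul]
    exact mul_div_cancel₀ _ (by linarith)
  simp only [mul_sub, mul_one, Finset.sum_sub_distrib] at hsum
  rw [real_inner_eq_sum_mul]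
  linarith

/-- **Lemma 3.2, cap part**: for `v ∈ S_+^{m−1}` and `−‖v‖_1 < s < ‖v‖_1`,
`P_m(C^+(v,s);β) ≍ ∏_i (min{(‖v‖_1−s)/(2v_i),1})^{β_i+1}`, the minimum being
interpreted as `1` when `v_i = 0`. -/
theorem metaCap_content_asymp
    (m : ℕ) (hm : 1 ≤ m) (β : Fin m → ℝ) (hβ : ∀ i, -1 < β i) :
    ∃ c C : ℝ, 0 < c ∧ c ≤ C ∧
      ∀ (v : EuclideanSpace ℝ (Fin m)) (s : ℝ),
        ‖v‖ = 1 → (∀ i, 0 ≤ v i) → -(∑ i, v i) < s → s < ∑ i, v i →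
        (c * ∏ i, (if v i = 0 then 1 else
              min (((∑ j, v j) - s) / (2 * v i)) 1) ^ (β i + 1)
            ≤ betaContent β (metaCap v s)) ∧
        betaContent β (metaCap v s)
          ≤ C * ∏ i, (if v i = 0 then 1 else
              min (((∑ j, v j) - s) / (2 * v i)) 1) ^ (β i + 1) := by
  choose k hk hkle using fun i => exists_lower_bound_setIntegral_betaDensity (hβ i)
  choose K hK hKle using fun i => exists_upper_bound_setIntegral_betaDensity (hβ i)
  have hm1 : (1 : ℝ) ≤ m := by exact_mod_cast hm
  have hM : (0 : ℝ) < 2 * m := by linarith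
  refine ⟨∏ i, k i / (2 * m : ℝ) ^ (β i + 1), max (∏ i, k i / (2 * m : ℝ) ^ (β i + 1)) (∏ i, K i),
    Finset.prod_pos fun i _ => div_pos (hk i) (Real.rpow_pos_of_pos hM _), le_max_left _ _, ?_⟩
  intro v s _ hv _ hs
  change _ * ∏ i, capRatio v s i ^ (β i + 1) ≤ _ ∧ _ ≤ _ * ∏ i, capRatio v s i ^ (β i + 1)
  have hr0 := capRatio_nonneg hv hs
  have hr1 := capRatio_le_one v s
  constructor
  · refine le_trans ?_ (betaContent_mono hβ (cornerBox_subset_metaCap hm hv hs)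
      (fun y hy => hy.1) (measurableSet_metaCap v s))
    rw [betaContent_cornerBox, ← Finset.prod_mul_distrib]
    refine Finset.prod_le_prod (fun i _ => mul_nonneg
      (div_pos (hk i) (Real.rpow_pos_of_pos hM _)).le (Real.rpow_nonneg (hr0 i) _)) fun i _ => ?_
    have hhalf : capRatio v s i / (2 * m) ≤ 1 / 2 := by
      rw [div_le_div_iff₀ hM two_pos]
      linarith [hr1 i]
    refine le_trans (le_of_eq ?_) (hkle i _ (div_nonneg (hr0 i) hM.le) hhalf)
    rw [Real.div_rpow (hr0 i) hM.le]
    ring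
  · refine (betaContent_mono hβ (metaCap_subset_cornerBox hv)
      (fun y hy => abs_le_one_of_mem_cornerBox hr1 hy) (measurableSet_cornerBox _)).trans ?_
    refine le_trans ?_ (mul_le_mul_of_nonneg_right (le_max_right _ _)
      (Finset.prod_nonneg fun i _ => Real.rpow_nonneg (hr0 i) _))
    rw [betaContent_cornerBox, ← Finset.prod_mul_distrib]
    refine Finset.prod_le_prod (fun i _ => setIntegral_nonneg measurableSet_Icc fun y hy => ?_)
      fun i _ => hKle i _ (hr0 i) (hr1 i)
    exact betaDensity_nonneg (hβ i) (abs_le.2 ⟨by linarith [hy.1, hr1 i], hy.2⟩)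
end
end
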